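/- For general lines L_1,…,L_6 in P^3 (i.e., there exists a nonzero polynomial P in the 48 coordinates of spanning vectors a_1,b_1,…,a_6,b_6 ∈ ℂ^4 such that whenever P does not vanish, each pair a_i,b_i is linearly independent, the subspaces L_i = span{a_i,b_i} pairwise intersect only in 0, and the following holds): for every integer m ≥ 1, the only homogeneous polynomial F of degree 72m − 1 in ℂ[x_0,x_1,x_2,x_3] with F ∈ I(L_i)^{19m} for all i = 1,…,6 is F = 0. -/

import Mathlib

open MvPolynomial

noncomputable section

abbrev C4 : Type := Fin 4 → ℂ
abbrev R3 : Type := MvPolynomial (Fin 4) ℂ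

/-- The homogeneous ideal of the line in `P^3` corresponding to a linear subspace
`L ⊆ ℂ^4`: all polynomials vanishing identically on `L`. -/
def lineIdeal (L : Submodule ℂ C4) : Ideal R3 where
  carrier := {F | ∀ v ∈ L, eval v F = 0}
  add_mem' := by
    intro a b ha hb v hv
    simp [ha v hv, hb v hv]
  zero_mem' := by
    intro v hv
    simp
  smul_mem' := by
    intro c F hF v hv
    simp [smul_eq_mul, hF v hv]

/-- A property `Q` holds for `s` *general* lines in `P^3`: there is a nonzero
polynomial `P` in the `8s` coordinates of spanning vectors such that whenever
`P` does not vanish, each pair of vectors is linearly independent, the spanned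
planes are pairwise disjoint, and `Q` holds for these lines. -/
def GeneralLines (s : ℕ) (Q : (Fin s → Submodule ℂ C4) → Prop) : Prop :=
  ∃ P : MvPolynomial (Fin s × Fin 2 × Fin 4) ℂ, P ≠ 0 ∧
    ∀ v : Fin s → Fin 2 → C4,
      MvPolynomial.eval (fun p => v p.1 p.2.1 p.2.2) P ≠ 0 →
      (∀ i, LinearIndependent ℂ ![v i 0, v i 1]) ∧
      (∀ i j, i ≠ j →
        Submodule.span ℂ {v i 0, v i 1} ⊓ Submodule.span ℂ {v j 0, v j 1} = ⊥) ∧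
      Q (fun i => Submodule.span ℂ {v i 0, v i 1})


namespace SixLines

/-! ### Constructions valid over an arbitrary commutative ring -/

section Constructions

variable {A B : Type*} [CommRing A] [CommRing B]

/-- `3 × 3` minors of three vectors. -/
def d3 (a b c : Fin 4 → A) (i j k : Fin 4) : A :=
  a i * (b j * c k - b k * c j) - a j * (b i * c k - b k * c i) + a k * (b i * c j - b j * c i)

/-- The covector orthogonal to three vectors. -/
def cross (a b c : Fin 4 → A) : Fin 4 → A :=
  ![d3 a b c 1 2 3, -d3 a b c 0 2 3, d3 a b c 0 1 3, -d3 a b c 0 1 2]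

def dot (x y : Fin 4 → A) : A := ∑ k, x k * y k

/-- The point of the `i`-th line lying in the plane `x`. -/
def dualpt (u : Fin 6 → Fin 2 → Fin 4 → A) (x : Fin 4 → A) (i : Fin 6) (k : Fin 4) : A :=
  dot x (u i 1) * u i 0 k - dot x (u i 0) * u i 1 k

/-- Eleven equations and one normalization row. -/
def theta (u : Fin 6 → Fin 2 → Fin 4 → A) (q : Fin 6 → Fin 4 → A) :
    Matrix (Fin 3 × Fin 4) (Fin 6 × Fin 2) A :=
  fun r c => if r = (2, 3) then (if c = (0, 0) then 1 else 0)
    else q c.1 r.1.succ * u c.1 c.2 r.2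

/-- The annihilators of the lines. -/
def perp (u : Fin 6 → Fin 2 → Fin 4 → A) : Fin 6 → Fin 2 → Fin 4 → A := fun i =>
  ![![u i 1 1 * u i 0 2 - u i 0 1 * u i 1 2, u i 0 0 * u i 1 2 - u i 1 0 * u i 0 2,
      -(u i 0 0 * u i 1 1 - u i 0 1 * u i 1 0), 0],
    ![u i 1 1 * u i 0 3 - u i 0 1 * u i 1 3, u i 0 0 * u i 1 3 - u i 1 0 * u i 0 3,
      0, -(u i 0 0 * u i 1 1 - u i 0 1 * u i 1 0)]]

set_option linter.unusedSectionVars false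

section Sol
variable {R C : Type*} [Fintype C] [DecidableEq C] [DecidableEq R]

/-- Cramer solution of `M v = e_{r0}`, up to the factor `det M`. -/
def sol (e : C ≃ R) (M : Matrix R C A) (r0 : R) : C → A :=
  (M.submatrix e id).adjugate.mulVec (Pi.single (e.symm r0) 1)

def dt (e : C ≃ R) (M : Matrix R C A) : A := (M.submatrix e id).det

lemma mulVec_sol (e : C ≃ R) (M : Matrix R C A) (r0 r : R) :
    (M.mulVec (sol e M r0)) r = if r = r0 then dt e M else 0 := by
  have h : (M.submatrix e id).mulVec (sol e M r0) = dt e M • Pi.single (e.symm r0) 1 := by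
    rw [sol, Matrix.mulVec_mulVec, Matrix.mul_adjugate, Matrix.smul_mulVec, Matrix.one_mulVec, dt]
  have h2 := congrFun h (e.symm r)
  have h3 : (M.submatrix e id).mulVec (sol e M r0) (e.symm r) = M.mulVec (sol e M r0) r := by
    simp [Matrix.mulVec, dotProduct]
  rw [h3] at h2
  rw [h2]
  by_cases hr : r = r0
  · subst hr; simp
  · have : e.symm r ≠ e.symm r0 := fun h => hr (e.symm.injective h)
    simp [hr]

lemma sol_eq (e : C ≃ R) (M : Matrix R C A) (r0 : R) (v : C → A)
    (hv : ∀ r, M.mulVec v r = if r = r0 then 1 else 0) :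
    sol e M r0 = dt e M • v := by
  have h : (M.submatrix e id).mulVec v = Pi.single (e.symm r0) 1 := by
    ext c
    have h3 : (M.submatrix e id).mulVec v c = M.mulVec v (e c) := by
      simp [Matrix.mulVec, dotProduct]
    rw [h3, hv]
    by_cases hr : e c = r0
    · subst hr; simp
    · have : c ≠ e.symm r0 := fun h => hr (by simp [h])
      simp [hr, this]
  rw [sol, ← h, Matrix.mulVec_mulVec, Matrix.adjugate_mul, Matrix.smul_mulVec, Matrix.one_mulVec, dt]

lemma eq_zero_of_mulVec [IsDomain A] (e : C ≃ R) (M : Matrix R C A) (h0 : dt e M ≠ 0) (v : C → A)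
    (hv : ∀ r, M.mulVec v r = 0) : v = 0 := by
  have h : (M.submatrix e id).mulVec v = 0 := by
    ext c
    have h3 : (M.submatrix e id).mulVec v c = M.mulVec v (e c) := by
      simp [Matrix.mulVec, dotProduct]
    rw [h3, hv]; rfl
  exact Matrix.eq_zero_of_mulVec_eq_zero h0 h

lemma dt_ne_zero [IsDomain A] (e : C ≃ R) (M : Matrix R C A)
    (h : ∀ v : C → A, (∀ r, M.mulVec v r = 0) → v = 0) : dt e M ≠ 0 := by
  intro h0
  obtain ⟨v, hv, hv'⟩ := Matrix.exists_mulVec_eq_zero_iff.mpr h0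
  refine hv (h v fun r => ?_)
  have h3 : (M.submatrix e id).mulVec v (e.symm r) = M.mulVec v r := by
    simp [Matrix.mulVec, dotProduct]
  rw [← h3, hv']; rfl

lemma map_dt (φ : A →+* B) (e : C ≃ R) (M : Matrix R C A) :
    φ (dt e M) = dt e (fun r c => φ (M r c)) := by
  rw [dt, RingHom.map_det]; rfl

lemma map_sol (φ : A →+* B) (e : C ≃ R) (M : Matrix R C A) (r0 : R) (c : C) :
    φ (sol e M r0 c) = sol e (fun r c => φ (M r c)) r0 c := by
  have := RingHom.map_mulVec φ (M.submatrix e id).adjugate (Pi.single (e.symm r0) 1) c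
  rw [sol, this, ← RingHom.mapMatrix_apply, RingHom.map_adjugate]
  have h2 : (φ ∘ (Pi.single (e.symm r0) 1 : C → A)) = Pi.single (e.symm r0) 1 := by
    ext d; simp [Pi.single_apply, apply_ite φ]
  rw [h2]; rfl

end Sol

/-- Number of coefficients to be killed in each row. -/
def dg (r : Fin 3 × Fin 4) : ℕ := if r = (2, 3) then 1 else if r.1 = 0 then 8 else 9

abbrev R2 : Type := Σ r : Fin 3 × Fin 4, Fin (dg r)
abbrev C2 : Type := (Fin 6 × Fin 2) × Fin 8

def e1 : (Fin 6 × Fin 2) ≃ (Fin 3 × Fin 4) := Fintype.equivOfCardEq (by simp)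

def e2 : C2 ≃ R2 := Fintype.equivOfCardEq (by decide)

def r02 : R2 := ⟨(2, 3), ⟨0, by decide⟩⟩

/-- the pencil `x0 + t e_1`. -/
def xt (x0 : Fin 4 → A) : Fin 4 → Polynomial A :=
  fun k => Polynomial.C (x0 k) + if k = 1 then Polynomial.X else 0

def cst (u : Fin 6 → Fin 2 → Fin 4 → A) : Fin 6 → Fin 2 → Fin 4 → Polynomial A :=
  fun i e k => Polynomial.C (u i e k)

def pt (ab : Fin 6 → Fin 2 → Fin 4 → A) (x0 : Fin 4 → A) : Fin 6 → Fin 4 → Polynomial A :=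
  dualpt (cst ab) (xt x0)

def Tt (ab : Fin 6 → Fin 2 → Fin 4 → A) (x0 : Fin 4 → A) :
    Matrix (Fin 3 × Fin 4) (Fin 6 × Fin 2) (Polynomial A) :=
  theta (cst (perp ab)) (pt ab x0)

def Smat (ab : Fin 6 → Fin 2 → Fin 4 → A) (x0 : Fin 4 → A) : Matrix R2 C2 A :=
  fun r c => (Tt ab x0 r.1 c.1 * Polynomial.X ^ (c.2 : ℕ)).coeff r.2

/-- polynomials with prescribed coefficients. -/
def pol (v : C2 → A) (c : Fin 6 × Fin 2) : Polynomial A :=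
  ∑ n : Fin 8, Polynomial.C (v (c, n)) * Polynomial.X ^ (n : ℕ)

/-- combine coefficients into vectors of the six planes. -/
def vec (u : Fin 6 → Fin 2 → Fin 4 → A) (z : Fin 6 × Fin 2 → A) (i : Fin 6) (k : Fin 4) : A :=
  ∑ e : Fin 2, z (i, e) * u i e k

def Yv (ab : Fin 6 → Fin 2 → Fin 4 → A) (v : C2 → A) : Fin 6 → Fin 4 → Polynomial A :=
  vec (cst (perp ab)) (pol v)

def wa (Y : Fin 6 → Fin 4 → A) : Fin 4 → A := cross (Y 0) (Y 1) (Y 2)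
def wb (Y : Fin 6 → Fin 4 → A) : Fin 4 → A := cross (Y 3) (Y 4) (Y 5)
def qa (q : Fin 6 → Fin 4 → A) : A := d3 (q 0) (q 1) (q 2) 1 2 3
def qb (q : Fin 6 → Fin 4 → A) : A := d3 (q 3) (q 4) (q 5) 1 2 3

/-- matrix of four linear forms. -/
def m4 (u : Fin 6 → Fin 2 → Fin 4 → A) (i j : Fin 6) : Matrix (Fin 4) (Fin 4) A :=
  ![u i 0, u i 1, u j 0, u j 1]

def Kmat (ab : Fin 6 → Fin 2 → Fin 4 → A) (xi : Fin 4 → A) :=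
  theta ab (dualpt (perp ab) xi)

/-- the inverse map, from the point `xi` to the plane `x0`. -/
def xx (ab : Fin 6 → Fin 2 → Fin 4 → A) (xi : Fin 4 → A) (th : A) : Fin 4 → A :=
  fun k => th * wa (vec ab (sol e1 (Kmat ab xi) (2, 3))) k

def leadc (ab : Fin 6 → Fin 2 → Fin 4 → A) (w : Fin 4 → Polynomial A) (i : Fin 6) : A :=
  dot (perp ab i 0) (fun k => (w k).coeff 21)

/-- Conditions on the lines and the point. -/
def N1 (ab : Fin 6 → Fin 2 → Fin 4 → A) (xi : Fin 4 → A) : A :=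
  (∏ i, (ab i 0 0 * ab i 1 1 - ab i 0 1 * ab i 1 0)) *
  (∏ i, ∏ j, if i = j then 1 else (m4 (perp ab) i j).det) *
  dt e1 (Kmat ab xi) * qa (dualpt (perp ab) xi) * (∏ i, dot xi (perp ab i 0)) * xi 0

/-- Conditions on the lines and the plane. -/
def N2 (ab : Fin 6 → Fin 2 → Fin 4 → A) (x0 : Fin 4 → A) : A :=
  (∏ i, dot x0 (ab i 1)) * dt e1 (theta (perp ab) (dualpt ab x0)) * dt e2 (Smat ab x0) * x0 0 *
  qa (dualpt ab x0)

/-- Conditions on the curve. -/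
def N3 (ab : Fin 6 → Fin 2 → Fin 4 → A) (v : C2 → A) : A :=
  Polynomial.resultant (wa (Yv ab v) 0) (wb (Yv ab v) 1) 21 21 *
  (∏ i, leadc ab (wa (Yv ab v)) i) * (wa (Yv ab v) 0).coeff 0

def NN (ab : Fin 6 → Fin 2 → Fin 4 → A) (xi : Fin 4 → A) (th : A) : A :=
  N1 ab xi * N2 ab (xx ab xi th) * N3 ab (sol e2 (Smat ab (xx ab xi th)) r02)

/-! ### Naturality -/

lemma map_d3 (φ : A →+* B) (a b c : Fin 4 → A) (i j k : Fin 4) :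
    φ (d3 a b c i j k) = d3 (fun s => φ (a s)) (fun s => φ (b s)) (fun s => φ (c s)) i j k := by
  simp [d3]

lemma map_cross (φ : A →+* B) (a b c : Fin 4 → A) (i : Fin 4) :
    φ (cross a b c i) = cross (fun s => φ (a s)) (fun s => φ (b s)) (fun s => φ (c s)) i := by
  fin_cases i <;> simp [cross, map_d3]

lemma map_dot (φ : A →+* B) (a b : Fin 4 → A) :
    φ (dot a b) = dot (fun s => φ (a s)) (fun s => φ (b s)) := by
  simp [dot]

lemma map_dualpt (φ : A →+* B) (u : Fin 6 → Fin 2 → Fin 4 → A) (x : Fin 4 → A) (i k) :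
    φ (dualpt u x i k) = dualpt (fun i e k => φ (u i e k)) (fun s => φ (x s)) i k := by
  simp [dualpt, map_dot]

lemma map_theta (φ : A →+* B) (u : Fin 6 → Fin 2 → Fin 4 → A) (q : Fin 6 → Fin 4 → A) (r c) :
    φ (theta u q r c) = theta (fun i e k => φ (u i e k)) (fun i k => φ (q i k)) r c := by
  simp only [theta]
  split_ifs <;> simp

lemma map_perp (φ : A →+* B) (u : Fin 6 → Fin 2 → Fin 4 → A) (i e k) :
    φ (perp u i e k) = perp (fun i e k => φ (u i e k)) i e k := by
  fin_cases e <;> fin_cases k <;> simp [perp]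

lemma map_vec (φ : A →+* B) (u : Fin 6 → Fin 2 → Fin 4 → A) (z : Fin 6 × Fin 2 → A) (i k) :
    φ (vec u z i k) = vec (fun i e k => φ (u i e k)) (fun c => φ (z c)) i k := by
  simp [vec]

lemma map_wa (φ : A →+* B) (Y : Fin 6 → Fin 4 → A) (k) :
    φ (wa Y k) = wa (fun i k => φ (Y i k)) k := map_cross _ _ _ _ _

lemma map_wb (φ : A →+* B) (Y : Fin 6 → Fin 4 → A) (k) :
    φ (wb Y k) = wb (fun i k => φ (Y i k)) k := map_cross _ _ _ _ _

lemma map_qa (φ : A →+* B) (q : Fin 6 → Fin 4 → A) :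
    φ (qa q) = qa (fun i k => φ (q i k)) := map_d3 _ _ _ _ _ _ _

lemma map_m4 (φ : A →+* B) (u : Fin 6 → Fin 2 → Fin 4 → A) (i j) :
    φ (m4 u i j).det = (m4 (fun i e k => φ (u i e k)) i j).det := by
  rw [RingHom.map_det]
  congr 1
  ext r s
  fin_cases r <;> rfl

lemma map_Tt (φ : A →+* B) (ab : Fin 6 → Fin 2 → Fin 4 → A) (x0 : Fin 4 → A) (r c) :
    (Tt ab x0 r c).map φ = Tt (fun i e k => φ (ab i e k)) (fun s => φ (x0 s)) r c := by
  have := map_theta (Polynomial.mapRingHom φ) (cst (perp ab)) (pt ab x0) r c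
  rw [Polynomial.coe_mapRingHom] at this
  rw [Tt, this, Tt]
  congr 1
  · ext1 i; ext1 e; ext1 k
    simp only [cst]
    rw [Polynomial.map_C, map_perp]
  · ext1 i; ext1 k
    have := map_dualpt (Polynomial.mapRingHom φ) (cst ab) (xt x0) i k
    rw [Polynomial.coe_mapRingHom] at this
    rw [pt, this, pt]
    congr 1
    · ext1 i; ext1 e; ext1 k
      simp [cst]
    · ext1 k
      simp only [xt]
      split_ifs <;> simp

lemma map_Smat (φ : A →+* B) (ab : Fin 6 → Fin 2 → Fin 4 → A) (x0 : Fin 4 → A) (r c) :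
    φ (Smat ab x0 r c) = Smat (fun i e k => φ (ab i e k)) (fun s => φ (x0 s)) r c := by
  simp only [Smat, ← map_Tt, ← Polynomial.coeff_map, Polynomial.map_mul, Polynomial.map_pow,
    Polynomial.map_X]

lemma map_Yv (φ : A →+* B) (ab : Fin 6 → Fin 2 → Fin 4 → A) (v : C2 → A) (i k) :
    (Yv ab v i k).map φ = Yv (fun i e k => φ (ab i e k)) (fun s => φ (v s)) i k := by
  have := map_vec (Polynomial.mapRingHom φ) (cst (perp ab)) (pol v) i k
  rw [Polynomial.coe_mapRingHom] at this
  rw [Yv, this, Yv]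
  congr 1
  · ext1 i; ext1 e; ext1 k
    simp only [cst]
    rw [Polynomial.map_C, map_perp]
  · ext1 c
    simp [pol, Polynomial.map_sum]

lemma map_waY (φ : A →+* B) (ab : Fin 6 → Fin 2 → Fin 4 → A) (v : C2 → A) (k) :
    (wa (Yv ab v) k).map φ = wa (Yv (fun i e k => φ (ab i e k)) (fun s => φ (v s))) k := by
  have := map_wa (Polynomial.mapRingHom φ) (Yv ab v) k
  rw [Polynomial.coe_mapRingHom] at this
  rw [this]; simp only [map_Yv]

lemma map_wbY (φ : A →+* B) (ab : Fin 6 → Fin 2 → Fin 4 → A) (v : C2 → A) (k) :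
    (wb (Yv ab v) k).map φ = wb (Yv (fun i e k => φ (ab i e k)) (fun s => φ (v s))) k := by
  have := map_wb (Polynomial.mapRingHom φ) (Yv ab v) k
  rw [Polynomial.coe_mapRingHom] at this
  rw [this]; simp only [map_Yv]

lemma map_Kmat (φ : A →+* B) (ab : Fin 6 → Fin 2 → Fin 4 → A) (xi : Fin 4 → A) (r c) :
    φ (Kmat ab xi r c) = Kmat (fun i e k => φ (ab i e k)) (fun s => φ (xi s)) r c := by
  simp only [Kmat, map_theta, map_dualpt, map_perp]

lemma map_xx (φ : A →+* B) (ab : Fin 6 → Fin 2 → Fin 4 → A) (xi : Fin 4 → A) (th : A) (k) :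
    φ (xx ab xi th k) = xx (fun i e k => φ (ab i e k)) (fun s => φ (xi s)) (φ th) k := by
  simp only [xx, map_mul, map_wa, map_vec, map_sol, map_Kmat]

lemma map_N1 (φ : A →+* B) (ab : Fin 6 → Fin 2 → Fin 4 → A) (xi : Fin 4 → A) :
    φ (N1 ab xi) = N1 (fun i e k => φ (ab i e k)) (fun s => φ (xi s)) := by
  simp only [N1, map_mul, map_prod, map_sub, map_dt, map_Kmat, map_qa, map_dualpt, map_perp,
    map_dot, apply_ite φ, map_one, map_m4]

lemma map_N2 (φ : A →+* B) (ab : Fin 6 → Fin 2 → Fin 4 → A) (xi : Fin 4 → A) :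
    φ (N2 ab xi) = N2 (fun i e k => φ (ab i e k)) (fun s => φ (xi s)) := by
  simp only [N2, map_mul, map_prod, map_dt, map_theta, map_qa, map_dualpt, map_perp,
    map_dot, map_Smat]

lemma map_N3 (φ : A →+* B) (ab : Fin 6 → Fin 2 → Fin 4 → A) (v : C2 → A) :
    φ (N3 ab v) = N3 (fun i e k => φ (ab i e k)) (fun s => φ (v s)) := by
  have h : φ (Polynomial.resultant (wa (Yv ab v) 0) (wb (Yv ab v) 1) 21 21) =
      Polynomial.resultant ((wa (Yv ab v) 0).map φ) ((wb (Yv ab v) 1).map φ) 21 21 :=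
    (Polynomial.resultant_map_map _ _ _ _ _).symm
  rw [map_waY, map_wbY] at h
  simp only [N3, leadc, map_mul, map_prod, map_perp, map_dot, ← Polynomial.coeff_map, map_waY, h]

lemma map_NN (φ : A →+* B) (ab : Fin 6 → Fin 2 → Fin 4 → A) (xi : Fin 4 → A) (th : A) :
    φ (NN ab xi th) = NN (fun i e k => φ (ab i e k)) (fun s => φ (xi s)) (φ th) := by
  simp only [NN, map_mul, map_N1, map_N2, map_N3, map_xx, map_sol, map_Smat]

end Constructions

/-! ### Linear algebra over a domain -/

section Domain

variable {A : Type*} [CommRing A]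

lemma theta_mulVec (v : Fin 6 → Fin 2 → Fin 4 → A) (q : Fin 6 → Fin 4 → A)
    (y : Fin 6 × Fin 2 → A) (k : Fin 3) (j : Fin 4) (h : (k, j) ≠ (2, 3)) :
    (theta v q).mulVec y (k, j) = ∑ i, q i k.succ * vec v y i j := by
  simp only [Matrix.mulVec, dotProduct, theta, h, if_false, Fintype.sum_prod_type, vec]
  refine Finset.sum_congr rfl fun i _ => ?_
  rw [Finset.mul_sum]
  exact Finset.sum_congr rfl fun e _ => by ring

lemma dot_dualpt (u : Fin 6 → Fin 2 → Fin 4 → A) (x : Fin 4 → A) (i : Fin 6) :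
    dot x (dualpt u x i) = 0 := by
  simp only [dot, dualpt, Fin.sum_univ_four]; ring

lemma dot_dualpt_vec (u v : Fin 6 → Fin 2 → Fin 4 → A)
    (huv : ∀ i e e', dot (v i e) (u i e') = 0) (x : Fin 4 → A) (y : Fin 6 × Fin 2 → A) (i : Fin 6) :
    dot (dualpt u x i) (vec v y i) = 0 := by
  have h00 := huv i 0 0
  have h01 := huv i 0 1
  have h10 := huv i 1 0
  have h11 := huv i 1 1
  have : dot (dualpt u x i) (vec v y i) =
      dot x (u i 1) * (y (i, 0) * dot (v i 0) (u i 0) + y (i, 1) * dot (v i 1) (u i 0))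
      - dot x (u i 0) * (y (i, 0) * dot (v i 0) (u i 1) + y (i, 1) * dot (v i 1) (u i 1)) := by
    have hd : dualpt u x i = fun k => dot x (u i 1) * u i 0 k - dot x (u i 0) * u i 1 k := rfl
    rw [hd]
    generalize dot x (u i 1) = p
    generalize dot x (u i 0) = q
    simp only [dot, vec, Fin.sum_univ_four, Fin.sum_univ_two]
    ring
  rw [this, h00, h01, h10, h11]; ring

lemma trace_lemma [IsDomain A] (u v : Fin 6 → Fin 2 → Fin 4 → A)
    (huv : ∀ i e e', dot (v i e) (u i e') = 0) (x : Fin 4 → A) (hx : x 0 ≠ 0)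
    (y : Fin 6 × Fin 2 → A)
    (h : ∀ r, r ≠ (2, 3) → (theta v (dualpt u x)).mulVec y r = 0) (k j : Fin 4) :
    ∑ i, dualpt u x i k * vec v y i j = 0 := by
  set Z : Fin 4 → Fin 4 → A := fun k j => ∑ i, dualpt u x i k * vec v y i j with hZ
  have hr : ∀ (k : Fin 3) (j : Fin 4), (k, j) ≠ (2, 3) → Z k.succ j = 0 := fun k j hkj => by
    exact (theta_mulVec _ _ _ _ _ hkj).symm.trans (h _ hkj)
  have hxz : ∀ j, ∑ k, x k * Z k j = 0 := fun j => by
    have : ∑ k, x k * Z k j = ∑ i, dot x (dualpt u x i) * vec v y i j := by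
      simp only [hZ, Finset.mul_sum, dot, Finset.sum_mul]
      rw [Finset.sum_comm]
      exact Finset.sum_congr rfl fun i _ => Finset.sum_congr rfl fun k _ => by ring
    rw [this]; simp [dot_dualpt]
  have htr : ∑ k, Z k k = 0 := by
    have : ∑ k, Z k k = ∑ i, dot (dualpt u x i) (vec v y i) := by
      simp only [hZ, dot]
      rw [Finset.sum_comm]
    rw [this]; simp [dot_dualpt_vec u v huv]
  have r1 : ∀ j, Z 1 j = 0 := fun j => hr 0 j (by simp)
  have r2 : ∀ j, Z 2 j = 0 := fun j => hr 1 j (by simp)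
  have r3 : ∀ j, j ≠ 3 → Z 3 j = 0 := fun j hj => hr 2 j (by simp [hj])
  have z00 : Z 0 0 = 0 := by
    have := hxz 0
    simp only [Fin.sum_univ_four, r1, r2, r3 0 (by decide)] at this
    simpa [hx] using this
  have z33 : Z 3 3 = 0 := by
    simpa [Fin.sum_univ_four, r1, r2, z00] using htr
  have r3' : ∀ j, Z 3 j = 0 := fun j => by
    by_cases hj : j = 3
    · rw [hj, z33]
    · exact r3 j hj
  have r0 : Z 0 j = 0 := by
    have := hxz j
    simp only [Fin.sum_univ_four, r1, r2, r3'] at this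
    simpa [hx] using this
  change Z k j = 0
  fin_cases k
  · exact r0
  · exact r1 j
  · exact r2 j
  · exact r3' j

lemma d3_eq_det (a b c : Fin 4 → A) (i j k : Fin 4) :
    d3 a b c i j k = (Matrix.of ![![a i, a j, a k], ![b i, b j, b k], ![c i, c j, c k]]).det := by
  rw [Matrix.det_fin_three]; simp [d3]; ring

lemma minor_identity (q Y : Fin 6 → Fin 4 → A)
    (h : ∀ k j, ∑ i, q i k * Y i j = 0) (a b c : Fin 4) :
    qa q * d3 (Y 0) (Y 1) (Y 2) a b c = -(qb q * d3 (Y 3) (Y 4) (Y 5) a b c) := by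
  simp only [qa, qb, d3_eq_det]
  rw [← Matrix.det_transpose, ← Matrix.det_mul, ← Matrix.det_transpose (Matrix.of ![![q 3 1, _, _], _, _]),
    ← Matrix.det_mul]
  have hneg : ∀ M : Matrix (Fin 3) (Fin 3) A, -M.det = (-M).det := fun M => by
    rw [Matrix.det_neg]; simp [pow_succ]
  rw [hneg]
  congr 1
  have h' : ∀ k j, q 0 k * Y 0 j + q 1 k * Y 1 j + q 2 k * Y 2 j =
      -(q 3 k * Y 3 j + q 4 k * Y 4 j + q 5 k * Y 5 j) := fun k j => by
    have := h k j
    rw [Fin.sum_univ_six] at this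
    linear_combination this
  ext k j
  fin_cases k <;> fin_cases j <;> simp [Matrix.mul_apply, Fin.sum_univ_three] <;>
    linear_combination h' _ _

lemma minor_identity' (q Y : Fin 6 → Fin 4 → A)
    (h : ∀ k j, ∑ i, q i k * Y i j = 0) (j : Fin 4) :
    qa q * wa Y j = -(qb q * wb Y j) := by
  have := minor_identity q Y h
  fin_cases j <;> simp [wa, wb, cross, this]

lemma dot_cross (a b c : Fin 4 → A) :
    dot (cross a b c) a = 0 ∧ dot (cross a b c) b = 0 ∧ dot (cross a b c) c = 0 := by
  refine ⟨?_, ?_, ?_⟩ <;> simp [dot, cross, d3, Fin.sum_univ_four] <;> ring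

lemma dot_wa [IsDomain A] (q Y : Fin 6 → Fin 4 → A)
    (h : ∀ k j, ∑ i, q i k * Y i j = 0) (hq : qa q ≠ 0) (i : Fin 6) :
    dot (wa Y) (Y i) = 0 := by
  have h1 : qa q * dot (wa Y) (Y i) = -(qb q * dot (wb Y) (Y i)) := by
    simp only [dot, Finset.mul_sum, ← mul_assoc, minor_identity' q Y h, ← Finset.sum_neg_distrib]
    exact Finset.sum_congr rfl fun k _ => by ring
  have ha := dot_cross (Y 0) (Y 1) (Y 2)
  have hb := dot_cross (Y 3) (Y 4) (Y 5)
  have key : dot (wb Y) (Y i) = 0 → dot (wa Y) (Y i) = 0 := fun h0 => by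
    rw [h0] at h1; simpa [hq] using h1
  fin_cases i
  · exact ha.1
  · exact ha.2.1
  · exact ha.2.2
  · exact key hb.1
  · exact key hb.2.1
  · exact key hb.2.2

lemma perp_dot (u : Fin 6 → Fin 2 → Fin 4 → A) (i e e') : dot (perp u i e) (u i e') = 0 := by
  fin_cases e <;> fin_cases e' <;> simp [dot, perp, Fin.sum_univ_four] <;> ring

lemma dot_comm (x y : Fin 4 → A) : dot x y = dot y x := by
  simp only [dot, mul_comm]

lemma perp_dot' (u : Fin 6 → Fin 2 → Fin 4 → A) (i e e') : dot (u i e) (perp u i e') = 0 := by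
  rw [dot_comm, perp_dot]

end Domain

/-! ### Curves meeting the six lines many times -/

section Curve

lemma eval_scale {F : R3} {n : ℕ} (hF : F.IsHomogeneous n) (c : ℂ) (x : Fin 4 → ℂ) :
    eval (fun k => c * x k) F = c ^ n * eval x F := by
  rw [eval_eq', eval_eq', Finset.mul_sum]
  refine Finset.sum_congr rfl fun d hd => ?_
  have h1 : ∑ i, d i = n := by
    have := hF (mem_support_iff.mp hd)
    rw [Finsupp.weight_apply, Finsupp.sum_fintype _ _ (by simp)] at this
    simpa using this
  simp only [mul_pow, Finset.prod_mul_distrib, Finset.prod_pow_eq_pow_sum, h1]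
  ring

lemma exists_gcd {n : ℕ} (w : Fin n → Polynomial ℂ) (k0 : Fin n) (h0 : w k0 ≠ 0) :
    ∃ (h : Polynomial ℂ) (x a : Fin n → Polynomial ℂ), h ≠ 0 ∧ (∀ k, w k = h * x k) ∧
      ∑ k, a k * x k = 1 := by
  obtain ⟨h, hh⟩ := (IsPrincipalIdealRing.principal (Ideal.span (Set.range w))).principal
  have hh' : Ideal.span (Set.range w) = Ideal.span {h} := hh
  have h1 : ∀ k, h ∣ w k := fun k => by
    rw [← Ideal.mem_span_singleton, ← hh']
    exact Ideal.subset_span ⟨k, rfl⟩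
  choose x hx using h1
  have h2 : h ∈ Ideal.span (Set.range w) := by rw [hh']; exact Ideal.mem_span_singleton_self h
  obtain ⟨a, ha⟩ := (Ideal.mem_span_range_iff_exists_fun).mp h2
  have hne : h ≠ 0 := fun h => h0 (by rw [hx, h, zero_mul])
  refine ⟨h, x, a, hne, hx, ?_⟩
  apply mul_left_cancel₀ hne
  rw [mul_one, Finset.mul_sum]
  conv_rhs => rw [← ha]
  exact Finset.sum_congr rfl fun k _ => by rw [hx k]; ring

lemma gcd_deg (f g s r : Polynomial ℂ) (hf : f ≠ 0) (hsr : s ≠ 0 ∨ r ≠ 0)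
    (h : s * f + r * g = 0) (hr : r.natDegree ≤ 7) :
    ∃ G, G ∣ f ∧ G ∣ g ∧ f.natDegree ≤ G.natDegree + 7 := by
  obtain ⟨G, x, a, hG, hx, ha⟩ := exists_gcd ![f, g] 0 (by simpa using hf)
  have hf' : f = G * x 0 := hx 0
  have hg' : g = G * x 1 := hx 1
  rw [Fin.sum_univ_two] at ha
  refine ⟨G, ⟨_, hf'⟩, ⟨_, hg'⟩, ?_⟩
  have hx0 : x 0 ≠ 0 := fun h => hf (by rw [hf', h, mul_zero])
  have h2 : s * x 0 + r * x 1 = 0 := by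
    apply mul_left_cancel₀ hG
    rw [hf', hg'] at h
    linear_combination h
  have hr0 : r ≠ 0 := by
    rintro rfl
    have : s = 0 := by simpa [hx0] using h2
    simp [this] at hsr
  have hd : x 0 ∣ r := ⟨a 0 * r - a 1 * s, by linear_combination -r * ha + a 1 * h2⟩
  have := Polynomial.natDegree_le_of_dvd hd hr0
  rw [hf', Polynomial.natDegree_mul hG hx0]
  omega

/-- the linear form `c` along the curve `x` -/
def lf (c : Fin 4 → ℂ) (x : Fin 4 → Polynomial ℂ) : Polynomial ℂ := ∑ k, Polynomial.C (c k) * x k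

lemma lineIdeal_dvd (ab : Fin 6 → Fin 2 → Fin 4 → ℂ) (i : Fin 6)
    (hD : ab i 0 0 * ab i 1 1 - ab i 0 1 * ab i 1 0 ≠ 0) (x : Fin 4 → Polynomial ℂ)
    (G : Polynomial ℂ) (h0 : G ∣ lf (perp ab i 0) x) (h1 : G ∣ lf (perp ab i 1) x)
    (f : R3) (hf : f ∈ lineIdeal (Submodule.span ℂ {ab i 0, ab i 1})) : G ∣ aeval x f := by
  set D := ab i 0 0 * ab i 1 1 - ab i 0 1 * ab i 1 0 with hDdef
  set α : Polynomial ℂ := Polynomial.C (D⁻¹ * ab i 1 1) * x 0 - Polynomial.C (D⁻¹ * ab i 1 0) * x 1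
    with hα
  set β : Polynomial ℂ := Polynomial.C (D⁻¹ * ab i 0 0) * x 1 - Polynomial.C (D⁻¹ * ab i 0 1) * x 0
    with hβ
  set η : Fin 4 → Polynomial ℂ := fun k => α * Polynomial.C (ab i 0 k) + β * Polynomial.C (ab i 1 k)
    with hη
  have hzero : aeval η f = 0 := by
    apply Polynomial.funext
    intro t
    have h := comp_aeval_apply η (Polynomial.aeval t : Polynomial ℂ →ₐ[ℂ] ℂ) f
    simp only [Polynomial.coe_aeval_eq_eval] at h
    rw [h, Polynomial.eval_zero, aeval_eq_eval]
    apply hf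
    rw [Submodule.mem_span_pair]
    refine ⟨α.eval t, β.eval t, ?_⟩
    ext k
    simp [hη]
  have hDD : Polynomial.C D * Polynomial.C D⁻¹ = 1 := by
    rw [← Polynomial.C_mul, mul_inv_cancel₀ hD, Polynomial.C_1]
  have hcong : ∀ k, G ∣ x k - η k := by
    have e0 : η 0 = x 0 := by
      simp only [hη, hα, hβ, Polynomial.C_mul]
      rw [hDdef] at hDD ⊢
      simp only [Polynomial.C_sub, Polynomial.C_mul] at hDD ⊢
      linear_combination x 0 * hDD
    have e1 : η 1 = x 1 := by
      simp only [hη, hα, hβ, Polynomial.C_mul]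
      rw [hDdef] at hDD ⊢
      simp only [Polynomial.C_sub, Polynomial.C_mul] at hDD ⊢
      linear_combination x 1 * hDD
    have e2 : x 2 - η 2 = -(Polynomial.C D⁻¹ * lf (perp ab i 0) x) := by
      simp only [hη, hα, hβ, Polynomial.C_mul, lf, Fin.sum_univ_four, perp]
      rw [hDdef] at hDD ⊢
      simp only [Polynomial.C_sub, Polynomial.C_mul] at hDD ⊢
      simp
      linear_combination -x 2 * hDD
    have e3 : x 3 - η 3 = -(Polynomial.C D⁻¹ * lf (perp ab i 1) x) := by
      simp only [hη, hα, hβ, Polynomial.C_mul, lf, Fin.sum_univ_four, perp]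
      rw [hDdef] at hDD ⊢
      simp only [Polynomial.C_sub, Polynomial.C_mul] at hDD ⊢
      simp
      linear_combination -x 3 * hDD
    intro k
    fin_cases k
    · change G ∣ x 0 - η 0
      rw [e0, sub_self]; exact dvd_zero _
    · change G ∣ x 1 - η 1
      rw [e1, sub_self]; exact dvd_zero _
    · change G ∣ x 2 - η 2
      rw [e2]; exact (Dvd.dvd.mul_left h0 _).neg_right
    · change G ∣ x 3 - η 3
      rw [e3]; exact (Dvd.dvd.mul_left h1 _).neg_right
  rw [← Ideal.mem_span_singleton, ← Ideal.Quotient.eq_zero_iff_mem]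
  have hx := comp_aeval_apply x (Ideal.Quotient.mkₐ ℂ (Ideal.span {G})) f
  have hy := comp_aeval_apply η (Ideal.Quotient.mkₐ ℂ (Ideal.span {G})) f
  have hxy : (fun k => Ideal.Quotient.mkₐ ℂ (Ideal.span {G}) (x k)) =
      fun k => Ideal.Quotient.mkₐ ℂ (Ideal.span {G}) (η k) := by
    ext1 k
    rw [Ideal.Quotient.mkₐ_eq_mk, Ideal.Quotient.eq, Ideal.mem_span_singleton]
    exact hcong k
  rw [hxy, ← hy, hzero, map_zero] at hx
  exact hx

lemma lineIdeal_pow_dvd (ab : Fin 6 → Fin 2 → Fin 4 → ℂ) (i : Fin 6)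
    (hD : ab i 0 0 * ab i 1 1 - ab i 0 1 * ab i 1 0 ≠ 0) (x : Fin 4 → Polynomial ℂ)
    (G : Polynomial ℂ) (h0 : G ∣ lf (perp ab i 0) x) (h1 : G ∣ lf (perp ab i 1) x)
    (n : ℕ) (f : R3) (hf : f ∈ lineIdeal (Submodule.span ℂ {ab i 0, ab i 1}) ^ n) :
    G ^ n ∣ aeval x f := by
  have h := Ideal.mem_map_of_mem (aeval x : R3 →ₐ[ℂ] Polynomial ℂ) hf
  rw [Ideal.map_pow] at h
  have hle : Ideal.map (aeval x : R3 →ₐ[ℂ] Polynomial ℂ)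
      (lineIdeal (Submodule.span ℂ {ab i 0, ab i 1})) ≤ Ideal.span {G} := by
    rw [Ideal.map_le_iff_le_comap]
    intro g hg
    rw [Ideal.mem_comap, Ideal.mem_span_singleton]
    exact lineIdeal_dvd ab i hD x G h0 h1 g hg
  have := Ideal.pow_right_mono hle n h
  rwa [Ideal.span_singleton_pow, Ideal.mem_span_singleton] at this

lemma coprime_of_m4 (u : Fin 6 → Fin 2 → Fin 4 → ℂ) (i j : Fin 6)
    (hm : (m4 u i j).det ≠ 0) (x a : Fin 4 → Polynomial ℂ)
    (ha : ∑ k, a k * x k = 1) (G H : Polynomial ℂ)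
    (hG : ∀ e, G ∣ lf (u i e) x) (hH : ∀ e, H ∣ lf (u j e) x) : IsCoprime G H := by
  set I : Ideal (Polynomial ℂ) := Ideal.span {G, H} with hI
  have hGI : ∀ f, G ∣ f → f ∈ I := fun f hf =>
    I.mem_of_dvd hf (Ideal.subset_span (by simp))
  have hHI : ∀ f, H ∣ f → f ∈ I := fun f hf =>
    I.mem_of_dvd hf (Ideal.subset_span (by simp))
  set M := m4 u i j
  have hrow : ∀ r, lf (M r) x ∈ I := fun r => by
    fin_cases r
    · exact hGI _ (hG 0)
    · exact hGI _ (hG 1)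
    · exact hHI _ (hH 0)
    · exact hHI _ (hH 1)
  have hx : ∀ k, Polynomial.C M.det * x k ∈ I := fun k => by
    have : Polynomial.C M.det * x k = ∑ r, Polynomial.C (M.adjugate k r) * lf (M r) x := by
      simp only [lf, Finset.mul_sum]
      rw [Finset.sum_comm]
      have h2 : ∀ l, ∑ r, Polynomial.C (M.adjugate k r) * (Polynomial.C (M r l) * x l) =
          Polynomial.C ((M.adjugate * M) k l) * x l := fun l => by
        rw [Matrix.mul_apply, map_sum, Finset.sum_mul]
        exact Finset.sum_congr rfl fun r _ => by rw [Polynomial.C_mul]; ring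
      simp only [h2, Matrix.adjugate_mul, Matrix.smul_apply, Matrix.one_apply]
      simp [apply_ite Polynomial.C, ite_mul]
    rw [this]
    exact I.sum_mem fun r _ => I.mul_mem_left _ (hrow r)
  have h1 : (1 : Polynomial ℂ) ∈ I := by
    have : (1 : Polynomial ℂ) = ∑ k, Polynomial.C M.det⁻¹ * a k * (Polynomial.C M.det * x k) := by
      have hc : Polynomial.C M.det⁻¹ * Polynomial.C M.det = 1 := by
        rw [← Polynomial.C_mul, inv_mul_cancel₀ hm, Polynomial.C_1]
      rw [← ha]
      refine Finset.sum_congr rfl fun k _ => ?_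
      linear_combination -a k * x k * hc
    rw [this]
    exact I.sum_mem fun k _ => I.mul_mem_left _ (hx k)
  exact Ideal.mem_span_pair.mp h1

lemma lf_mul (c : Fin 4 → ℂ) (h : Polynomial ℂ) (w x : Fin 4 → Polynomial ℂ)
    (hw : ∀ k, w k = h * x k) : lf c w = h * lf c x := by
  simp only [lf, hw, Finset.mul_sum]
  exact Finset.sum_congr rfl fun k _ => by ring

theorem curve_vanish (ab : Fin 6 → Fin 2 → Fin 4 → ℂ)
    (hD : ∀ i, ab i 0 0 * ab i 1 1 - ab i 0 1 * ab i 1 0 ≠ 0)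
    (hm : ∀ i j, i ≠ j → (m4 (perp ab) i j).det ≠ 0)
    (w w' : Fin 4 → Polynomial ℂ) (q q' : Polynomial ℂ) (hqw : ∀ j, q * w j = -(q' * w' j))
    (hq : q ≠ 0) (hq' : q'.natDegree ≤ 2) (hw : ∀ j, (w j).natDegree ≤ 21)
    (hcop : IsCoprime (w 0) (w' 1)) (hw0 : w 0 ≠ 0)
    (y : Fin 6 × Fin 2 → Polynomial ℂ) (hy : ∀ c, (y c).natDegree ≤ 7)
    (hy0 : ∀ i, y (i, 0) ≠ 0 ∨ y (i, 1) ≠ 0)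
    (hdot : ∀ i, dot w (vec (cst (perp ab)) y i) = 0) (hlead : ∀ i, leadc ab w i ≠ 0)
    (m : ℕ) (hm1 : 1 ≤ m) (F : R3) (hF : F.IsHomogeneous (72 * m - 1))
    (hFi : ∀ i, F ∈ lineIdeal (Submodule.span ℂ {ab i 0, ab i 1}) ^ (19 * m)) (t : ℂ) :
    eval (fun k => (w k).eval t) F = 0 := by
  obtain ⟨h, x, a, hh, hwx, hax⟩ := exists_gcd w 0 hw0
  have hq'0 : q' ≠ 0 := by
    rintro rfl
    have := hqw 0
    simp [hq, hw0] at this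
  have hhq : h ∣ q' := by
    have h1 : IsCoprime h (w' 1) := hcop.of_isCoprime_of_dvd_left ⟨_, hwx 0⟩
    apply h1.dvd_of_dvd_mul_right
    refine ⟨-(q * x 1), ?_⟩
    have := hqw 1
    rw [hwx] at this
    linear_combination this
  have hhdeg : h.natDegree ≤ 2 := (Polynomial.natDegree_le_of_dvd hhq hq'0).trans hq'
  obtain ⟨e, he⟩ : ∃ e, e + h.natDegree = 21 := ⟨21 - h.natDegree, by omega⟩
  have hxdeg : ∀ k, (x k).natDegree ≤ e := fun k => by
    by_cases hk : x k = 0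
    · simp [hk]
    · have := hw k
      rw [hwx, Polynomial.natDegree_mul hh hk] at this
      omega
  have hc : ∀ i, lf (perp ab i 0) x ≠ 0 ∧ (lf (perp ab i 0) x).natDegree = e := fun i => by
    have hco : (lf (perp ab i 0) w).coeff 21 ≠ 0 := by
      have := hlead i
      simpa [lf, leadc, dot, Polynomial.finsetSum_coeff] using this
    have h21 : (lf (perp ab i 0) w).natDegree = 21 := by
      apply le_antisymm
      · refine Polynomial.natDegree_sum_le_of_forall_le _ _ fun k _ => ?_
        exact (Polynomial.natDegree_C_mul_le _ _).trans (hw k)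
      · exact Polynomial.le_natDegree_of_ne_zero hco
    rw [lf_mul _ _ _ _ hwx] at hco h21
    have hne : lf (perp ab i 0) x ≠ 0 := fun h0 => hco (by rw [h0]; simp)
    refine ⟨hne, ?_⟩
    rw [Polynomial.natDegree_mul hh hne] at h21
    omega
  have hG : ∀ i, ∃ G, G ∣ lf (perp ab i 0) x ∧ G ∣ lf (perp ab i 1) x ∧
      (lf (perp ab i 0) x).natDegree ≤ G.natDegree + 7 := fun i => by
    refine gcd_deg _ _ (y (i, 0)) (y (i, 1)) (hc i).1 (hy0 i) ?_ (hy _)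
    apply mul_left_cancel₀ hh
    have := hdot i
    rw [mul_zero, ← this]
    simp only [dot, vec, cst, lf, hwx, Fin.sum_univ_four, Fin.sum_univ_two]
    ring
  choose G hG0 hG1 hGd using hG
  have hGne : ∀ i, G i ≠ 0 := fun i h0 => (hc i).1 (by
    have := hG0 i; rw [h0] at this; exact zero_dvd_iff.mp this)
  have hdiv : ∏ i, G i ^ (19 * m) ∣ aeval x F := by
    apply Finset.prod_dvd_of_coprime
    · intro i _ j _ hij
      apply IsCoprime.pow
      refine coprime_of_m4 (perp ab) i j (hm i j hij) x a hax _ _ ?_ ?_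
      · intro e; fin_cases e
        · exact hG0 i
        · exact hG1 i
      · intro e; fin_cases e
        · exact hG0 j
        · exact hG1 j
    · intro i _
      exact lineIdeal_pow_dvd ab i (hD i) x (G i) (hG0 i) (hG1 i) _ F (hFi i)
  have hzero : aeval x F = 0 := by
    by_contra hne
    have h1 := Polynomial.natDegree_le_of_dvd hdiv hne
    have h2 := MvPolynomial.aeval_natDegree_le F hF.totalDegree_le x hxdeg
    rw [Polynomial.natDegree_prod _ _ (fun i _ => pow_ne_zero _ (hGne i))] at h1
    simp only [Polynomial.natDegree_pow] at h1
    have h3 : ∀ i, e ≤ (G i).natDegree + 7 := fun i => by rw [← (hc i).2]; exact hGd i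
    have h4 : ∑ i : Fin 6, 19 * m * (e - 7) ≤ ∑ i, 19 * m * (G i).natDegree := by
      refine Finset.sum_le_sum fun i _ => Nat.mul_le_mul_left _ ?_
      have := h3 i
      omega
    simp at h4
    have h5 := (h4.trans h1).trans h2
    obtain ⟨n, rfl⟩ : ∃ n, m = n + 1 := ⟨m - 1, by omega⟩
    obtain ⟨f, rfl⟩ : ∃ f, e = f + 19 := ⟨e - 19, by omega⟩
    have e1 : 72 * (n + 1) - 1 = 72 * n + 71 := by omega
    have e2 : f + 19 - 7 = f + 12 := by omega
    rw [e1, e2] at h5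
    nlinarith
  have hxt : eval (fun k => (x k).eval t) F = 0 := by
    have h := comp_aeval_apply x (Polynomial.aeval t : Polynomial ℂ →ₐ[ℂ] ℂ) F
    simp only [Polynomial.coe_aeval_eq_eval] at h
    rw [hzero, Polynomial.eval_zero, aeval_eq_eval] at h
    exact h.symm
  have : (fun k => (w k).eval t) = fun k => h.eval t * (x k).eval t := by
    ext k; rw [hwx, Polynomial.eval_mul]
  rw [this, eval_scale hF, hxt, mul_zero]

end Curve

/-! ### The pencil -/

section Pencil

variable {A : Type*} [CommRing A]

lemma pol_natDegree (v : C2 → A) (c) : (pol v c).natDegree ≤ 7 := by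
  refine Polynomial.natDegree_sum_le_of_forall_le _ _ fun n _ => ?_
  exact (Polynomial.natDegree_C_mul_X_pow_le _ _).trans (by omega)

lemma pol_eval_zero (v : C2 → A) (c) : (pol v c).eval 0 = v (c, 0) := by
  simp [pol, Fin.sum_univ_eight]

lemma pt_eq (ab : Fin 6 → Fin 2 → Fin 4 → A) (x0 : Fin 4 → A) (i : Fin 6) (k : Fin 4) :
    pt ab x0 i k = Polynomial.C (dualpt ab x0 i k) +
      Polynomial.C (ab i 1 1 * ab i 0 k - ab i 0 1 * ab i 1 k) * Polynomial.X := by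
  simp only [pt, dualpt, cst, xt, dot, Fin.sum_univ_four]
  simp
  ring

lemma pt_natDegree (ab : Fin 6 → Fin 2 → Fin 4 → A) (x0 : Fin 4 → A) (i : Fin 6) (k : Fin 4) :
    (pt ab x0 i k).natDegree ≤ 1 := by
  rw [pt_eq]
  refine (Polynomial.natDegree_add_le _ _).trans (max_le (by simp) ?_)
  exact (Polynomial.natDegree_C_mul_le _ _).trans Polynomial.natDegree_X_le

lemma pt_natDegree_one (ab : Fin 6 → Fin 2 → Fin 4 → A) (x0 : Fin 4 → A) (i : Fin 6) :
    (pt ab x0 i 1).natDegree ≤ 0 := by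
  rw [pt_eq]
  have : ab i 1 1 * ab i 0 1 - ab i 0 1 * ab i 1 1 = 0 := by ring
  simp [this]

lemma d3_natDegree (a b c : Fin 4 → Polynomial A) (i j k : Fin 4) (n1 n2 n3 : ℕ)
    (ha : ∀ s ∈ [a, b, c], (s i).natDegree ≤ n1 ∧ (s j).natDegree ≤ n2 ∧ (s k).natDegree ≤ n3) :
    (d3 a b c i j k).natDegree ≤ n1 + n2 + n3 := by
  have h : ∀ p q r : Polynomial A, p.natDegree ≤ n1 → q.natDegree ≤ n2 → r.natDegree ≤ n3 →
      (p * q * r).natDegree ≤ n1 + n2 + n3 := fun p q r hp hq hr =>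
    Polynomial.natDegree_mul_le_of_le (Polynomial.natDegree_mul_le_of_le hp hq) hr
  have hA := ha a (by simp)
  have hB := ha b (by simp)
  have hC := ha c (by simp)
  have e : d3 a b c i j k = a i * b j * c k - a i * c j * b k - b i * a j * c k + c i * a j * b k +
    b i * c j * a k - c i * b j * a k := by simp only [d3]; ring
  rw [e]
  have hs : ∀ p q : Polynomial A, p.natDegree ≤ n1 + n2 + n3 → q.natDegree ≤ n1 + n2 + n3 →
      (p - q).natDegree ≤ n1 + n2 + n3 := fun p q hp hq =>
    (Polynomial.natDegree_sub_le _ _).trans (max_le hp hq)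
  have hadd : ∀ p q : Polynomial A, p.natDegree ≤ n1 + n2 + n3 → q.natDegree ≤ n1 + n2 + n3 →
      (p + q).natDegree ≤ n1 + n2 + n3 := fun p q hp hq =>
    (Polynomial.natDegree_add_le _ _).trans (max_le hp hq)
  exact hs _ _ (hadd _ _ (hadd _ _ (hs _ _ (hs _ _ (h _ _ _ hA.1 hB.2.1 hC.2.2)
    (h _ _ _ hA.1 hC.2.1 hB.2.2)) (h _ _ _ hB.1 hA.2.1 hC.2.2)) (h _ _ _ hC.1 hA.2.1 hB.2.2))
    (h _ _ _ hB.1 hC.2.1 hA.2.2)) (h _ _ _ hC.1 hB.2.1 hA.2.2)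

lemma cross_natDegree (a b c : Fin 4 → Polynomial A) (h : ∀ s ∈ [a, b, c], ∀ k, (s k).natDegree ≤ 7)
    (k : Fin 4) : (cross a b c k).natDegree ≤ 21 := by
  have := fun i j k => d3_natDegree a b c i j k 7 7 7 (fun s hs => ⟨h s hs _, h s hs _, h s hs _⟩)
  fin_cases k <;> simp [cross, this]

lemma Yv_natDegree (ab : Fin 6 → Fin 2 → Fin 4 → A) (v : C2 → A) (i k) :
    (Yv ab v i k).natDegree ≤ 7 := by
  simp only [Yv, vec, cst]
  refine Polynomial.natDegree_sum_le_of_forall_le _ _ fun n _ => ?_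
  exact (Polynomial.natDegree_mul_C_le _ _).trans (pol_natDegree _ _)

lemma waY_natDegree (ab : Fin 6 → Fin 2 → Fin 4 → A) (v : C2 → A) (k) :
    (wa (Yv ab v) k).natDegree ≤ 21 := by
  apply cross_natDegree
  simp [Yv_natDegree]

lemma wbY_natDegree (ab : Fin 6 → Fin 2 → Fin 4 → A) (v : C2 → A) (k) :
    (wb (Yv ab v) k).natDegree ≤ 21 := by
  apply cross_natDegree
  simp [Yv_natDegree]

lemma qb_natDegree (ab : Fin 6 → Fin 2 → Fin 4 → A) (x0 : Fin 4 → A) :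
    (qb (pt ab x0)).natDegree ≤ 2 := by
  apply (d3_natDegree _ _ _ _ _ _ 0 1 1 _).trans (by norm_num)
  simp [pt_natDegree, -nonpos_iff_eq_zero]
  simp [Nat.le_zero.mp (pt_natDegree_one ab x0 _)]

lemma Smat_mulVec (ab : Fin 6 → Fin 2 → Fin 4 → A) (x0 : Fin 4 → A) (v : C2 → A) (r : R2) :
    (Smat ab x0).mulVec v r = ((Tt ab x0).mulVec (pol v) r.1).coeff r.2 := by
  simp only [Matrix.mulVec, dotProduct, Smat, Polynomial.finsetSum_coeff, pol, Finset.mul_sum,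
    Fintype.sum_prod_type]
  refine Finset.sum_congr rfl fun i _ => Finset.sum_congr rfl fun e _ =>
    Finset.sum_congr rfl fun n _ => ?_
  have h : Tt ab x0 r.1 (i, e) * (Polynomial.C (v ((i, e), n)) * Polynomial.X ^ (n : ℕ)) =
      Polynomial.C (v ((i, e), n)) * (Tt ab x0 r.1 (i, e) * Polynomial.X ^ (n : ℕ)) := by ring
  rw [h, Polynomial.coeff_C_mul, mul_comm]

lemma Tt_natDegree (ab : Fin 6 → Fin 2 → Fin 4 → A) (x0 : Fin 4 → A) (r c) (hr : r ≠ (2, 3)) :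
    (Tt ab x0 r c).natDegree + 8 ≤ dg r := by
  have h : (Tt ab x0 r c).natDegree ≤ (pt ab x0 c.1 r.1.succ).natDegree := by
    simp only [Tt, theta, hr, if_false, cst]
    exact Polynomial.natDegree_mul_C_le _ _
  by_cases h0 : r.1 = 0
  · have := pt_natDegree_one ab x0 c.1
    rw [h0] at h
    simp only [dg, hr, if_false, h0, if_true]
    have := h.trans this
    omega
  · have := h.trans (pt_natDegree ab x0 c.1 _)
    simp only [dg, hr, if_false, h0]
    omega

lemma Tt_mulVec_zero (ab : Fin 6 → Fin 2 → Fin 4 → A) (x0 : Fin 4 → A) (v : C2 → A)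
    (h : ∀ r, r ≠ r02 → (Smat ab x0).mulVec v r = 0) (r) (hr : r ≠ (2, 3)) :
    (Tt ab x0).mulVec (pol v) r = 0 := by
  ext l
  rw [Polynomial.coeff_zero]
  by_cases hl : l < dg r
  · have := Smat_mulVec ab x0 v ⟨r, ⟨l, hl⟩⟩
    rw [h] at this
    · exact this.symm
    · intro h'
      exact hr (congrArg Sigma.fst h')
  · apply Polynomial.coeff_eq_zero_of_natDegree_lt
    refine lt_of_le_of_lt (b := dg r - 1) ?_ ?_
    · simp only [Matrix.mulVec, dotProduct]
      refine Polynomial.natDegree_sum_le_of_forall_le _ _ fun c _ => ?_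
      have h1 := Tt_natDegree ab x0 r c hr
      have h2 := Polynomial.natDegree_mul_le (p := Tt ab x0 r c) (q := pol v c)
      have h3 := pol_natDegree v c
      omega
    · have : 0 < dg r := by
        rw [dg]; split_ifs <;> norm_num
      omega

lemma theta_norm (u : Fin 6 → Fin 2 → Fin 4 → A) (q : Fin 6 → Fin 4 → A) (y : Fin 6 × Fin 2 → A) :
    (theta u q).mulVec y (2, 3) = y (0, 0) := by
  simp [Matrix.mulVec, dotProduct, theta]

lemma pt_eval_zero (ab : Fin 6 → Fin 2 → Fin 4 → A) (x0 : Fin 4 → A) (i k) :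
    (pt ab x0 i k).eval 0 = dualpt ab x0 i k := by
  rw [pt_eq]; simp

lemma Tt_eval_zero (ab : Fin 6 → Fin 2 → Fin 4 → A) (x0 : Fin 4 → A) (r c) :
    (Tt ab x0 r c).eval 0 = theta (perp ab) (dualpt ab x0) r c := by
  simp only [Tt, theta]
  split_ifs <;> simp [pt_eval_zero, cst]

lemma Tt_mulVec_eval_zero (ab : Fin 6 → Fin 2 → Fin 4 → A) (x0 : Fin 4 → A)
    (y : Fin 6 × Fin 2 → Polynomial A) (r) :
    ((Tt ab x0).mulVec y r).eval 0 =
      (theta (perp ab) (dualpt ab x0)).mulVec (fun c => (y c).eval 0) r := by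
  simp [Matrix.mulVec, dotProduct, Polynomial.eval_finsetSum, Tt_eval_zero]

lemma Yv_eval_zero (ab : Fin 6 → Fin 2 → Fin 4 → A) (v : C2 → A) (i k) :
    (Yv ab v i k).eval 0 = vec (perp ab) (fun c => v (c, 0)) i k := by
  simp [Yv, vec, pol_eval_zero, cst]

lemma cst_dot (ab : Fin 6 → Fin 2 → Fin 4 → A) (i e e') :
    dot (cst (perp ab) i e) (cst ab i e') = 0 := by
  have := map_dot (Polynomial.C : A →+* Polynomial A) (perp ab i e) (ab i e')
  rw [perp_dot, map_zero] at this
  exact this.symm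

lemma cross_prop (x a b c : Fin 4 → A) (ha : dot x a = 0) (hb : dot x b = 0) (hc : dot x c = 0)
    (j : Fin 4) : x 0 * cross a b c j = x j * cross a b c 0 := by
  simp only [dot, Fin.sum_univ_four] at ha hb hc
  fin_cases j <;> simp [cross, d3]
  · linear_combination -((b 2 * c 3 - b 3 * c 2) * ha - (a 2 * c 3 - a 3 * c 2) * hb +
      (a 2 * b 3 - a 3 * b 2) * hc)
  · linear_combination ((b 1 * c 3 - b 3 * c 1) * ha - (a 1 * c 3 - a 3 * c 1) * hb +
      (a 1 * b 3 - a 3 * b 1) * hc)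
  · linear_combination -((b 1 * c 2 - b 2 * c 1) * ha - (a 1 * c 2 - a 2 * c 1) * hb +
      (a 1 * b 2 - a 2 * b 1) * hc)

lemma wa_ne (Y : Fin 6 → Fin 4 → A) (q : Fin 6 → Fin 4 → A) [IsDomain A] (hq : qa q ≠ 0)
    (hqw : ∀ j, qa q * wa Y j = -(qb q * wb Y j)) (hw : wa Y 0 ≠ 0) (i : Fin 6) : Y i ≠ 0 := by
  intro hi
  have hb : wb Y 0 ≠ 0 := fun h => by
    have := hqw 0
    rw [h] at this
    simp [hq, hw] at this
  fin_cases i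
  · exact hw (by simp at hi; simp [wa, cross, d3, hi])
  · exact hw (by simp at hi; simp [wa, cross, d3, hi])
  · exact hw (by simp at hi; simp [wa, cross, d3, hi])
  · exact hb (by simp at hi; simp [wb, cross, d3, hi])
  · exact hb (by simp at hi; simp [wb, cross, d3, hi])
  · exact hb (by simp at hi; simp [wb, cross, d3, hi])

end Pencil

/-! ### Vanishing at general points -/

section Main

lemma dot_smul_left {A : Type*} [CommRing A] (c : A) (x y : Fin 4 → A) :
    dot (fun k => c * x k) y = c * dot x y := by
  simp only [dot, Finset.mul_sum, mul_assoc]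

lemma dot_vec {A : Type*} [CommRing A] (x : Fin 4 → A) (u : Fin 6 → Fin 2 → Fin 4 → A)
    (z : Fin 6 × Fin 2 → A) (i : Fin 6) :
    dot x (vec u z i) = z (i, 0) * dot x (u i 0) + z (i, 1) * dot x (u i 1) := by
  simp only [dot, vec, Fin.sum_univ_four, Fin.sum_univ_two]; ring

/-- inverse map: `xi` is the image of the plane `x0`. -/
lemma inverse_point (ab : Fin 6 → Fin 2 → Fin 4 → ℂ) (xi : Fin 4 → ℂ) (th : ℂ)
    (hK : dt e1 (Kmat ab xi) ≠ 0) (hqB : qa (dualpt (perp ab) xi) ≠ 0)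
    (hxc : ∀ i, dot xi (perp ab i 0) ≠ 0) (hxi : xi 0 ≠ 0)
    (hb : ∀ i, dot (xx ab xi th) (ab i 1) ≠ 0) :
    ∃ y' : Fin 6 × Fin 2 → ℂ, y' ≠ 0 ∧ (∀ i, dot xi (vec (perp ab) y' i) = 0) ∧
      ∀ r, r ≠ (2, 3) → (theta (perp ab) (dualpt ab (xx ab xi th))).mulVec y' r = 0 := by
  set z := sol e1 (Kmat ab xi) (2, 3) with hz
  have hz0 : z (0, 0) ≠ 0 := by
    have := mulVec_sol e1 (Kmat ab xi) (2, 3) (2, 3)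
    rw [Kmat, theta_norm, if_pos rfl] at this
    rw [hz, Kmat, this]; exact hK
  have hB := trace_lemma (perp ab) ab (perp_dot' ab) xi hxi z (fun r hr => by
    have := mulVec_sol e1 (Kmat ab xi) (2, 3) r
    rw [if_neg hr] at this; exact this)
  have hdz := dot_wa _ _ hB hqB
  set x0 := xx ab xi th with hx0
  have hx0z : ∀ i, z (i, 0) * dot x0 (ab i 0) + z (i, 1) * dot x0 (ab i 1) = 0 := fun i => by
    rw [← dot_vec, hx0]
    have := dot_smul_left th (wa (vec ab z)) (vec ab z i)
    rw [hdz, mul_zero] at this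
    exact this
  set μ : Fin 6 → ℂ := fun i => z (i, 0) / dot x0 (ab i 1) with hμ
  have hzp : ∀ i k, vec ab z i k = μ i * dualpt ab x0 i k := fun i k => by
    have h1 := hx0z i
    have h2 := hb i
    simp only [hμ, dualpt, vec, Fin.sum_univ_two]
    field_simp
    linear_combination ab i 1 k * h1
  refine ⟨fun c => if c.2 = 0 then μ c.1 * dot xi (perp ab c.1 1)
    else -(μ c.1 * dot xi (perp ab c.1 0)), ?_, ?_, ?_⟩
  · intro h
    have := congrFun h (0, 1)
    simp only [hμ] at this
    simp [hz0, hb, hxc] at this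
  · intro i
    rw [dot_vec]; simp; ring
  · rintro ⟨k, j⟩ hr
    rw [theta_mulVec _ _ _ _ _ hr]
    have := hB j k.succ
    rw [← this]
    refine Finset.sum_congr rfl fun i _ => ?_
    rw [hzp]
    simp [vec, dualpt]; ring

theorem main_vanish (ab : Fin 6 → Fin 2 → Fin 4 → ℂ) (xi : Fin 4 → ℂ) (th : ℂ)
    (hN : NN ab xi th ≠ 0) (m : ℕ) (hm1 : 1 ≤ m) (F : R3) (hF : F.IsHomogeneous (72 * m - 1))
    (hFi : ∀ i, F ∈ lineIdeal (Submodule.span ℂ {ab i 0, ab i 1}) ^ (19 * m)) :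
    eval xi F = 0 := by
  simp only [NN, N1, N2, N3, mul_ne_zero_iff, Finset.prod_ne_zero_iff, Finset.mem_univ,
    true_imp_iff] at hN
  obtain ⟨⟨⟨⟨⟨⟨⟨hD, hm⟩, hK⟩, hqB⟩, hxc⟩, hxi⟩, ⟨⟨⟨hb, hT⟩, hS⟩, hx00⟩, hqp⟩, ⟨hres, hlead⟩, hw00⟩ := hN
  have hm' : ∀ i j, i ≠ j → (m4 (perp ab) i j).det ≠ 0 := fun i j hij => by
    have := hm i j
    rwa [if_neg hij] at this
  obtain ⟨y', hy'0, hy'x, hy'T⟩ := inverse_point ab xi th hK hqB hxc hxi hb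
  set x0 := xx ab xi th with hx0
  set v := sol e2 (Smat ab x0) r02 with hv
  have hvS : ∀ r, (Smat ab x0).mulVec v r = if r = r02 then dt e2 (Smat ab x0) else 0 :=
    mulVec_sol e2 (Smat ab x0) r02
  have hTt := Tt_mulVec_zero ab x0 v (fun r hr => by rw [hvS, if_neg hr])
  -- the value at `t = 0`
  set y0 : Fin 6 × Fin 2 → ℂ := fun c => v (c, 0) with hy0
  have hy00 : y0 (0, 0) ≠ 0 := by
    have h1 := Smat_mulVec ab x0 v r02
    rw [hvS, if_pos rfl] at h1
    have h2 : (Tt ab x0).mulVec (pol v) r02.1 = pol v (0, 0) := theta_norm _ _ _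
    have h3 : ((r02.2 : Fin _) : ℕ) = 0 := rfl
    rw [h2, h3, Polynomial.coeff_zero_eq_eval_zero, pol_eval_zero] at h1
    rw [hy0]; simp only; rw [← h1]; exact hS
  have hy0T : ∀ r, r ≠ (2, 3) → (theta (perp ab) (dualpt ab x0)).mulVec y0 r = 0 := fun r hr => by
    have := Tt_mulVec_eval_zero ab x0 (pol v) r
    rw [hTt r hr, Polynomial.eval_zero] at this
    simp only [pol_eval_zero] at this
    exact this.symm
  have hprop : ∀ c, y' (0, 0) * y0 c = y0 (0, 0) * y' c := by
    have := eq_zero_of_mulVec e1 _ hT (y' (0, 0) • y0 - y0 (0, 0) • y') (fun r => by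
      rw [Matrix.mulVec_sub, Matrix.mulVec_smul, Matrix.mulVec_smul]
      by_cases hr : r = (2, 3)
      · subst hr
        simp only [Pi.sub_apply, Pi.smul_apply, theta_norm, smul_eq_mul]
        ring
      · simp [hy0T r hr, hy'T r hr])
    intro c
    have := congrFun this c
    simp only [Pi.sub_apply, Pi.smul_apply, smul_eq_mul, Pi.zero_apply] at this
    linear_combination this
  have hy'00 : y' (0, 0) ≠ 0 := fun h => hy'0 (by
    ext c
    have := hprop c
    rw [h, zero_mul] at this
    simpa [hy00] using this.symm)
  have hxiy : ∀ i, dot xi (vec (perp ab) y0 i) = 0 := fun i => by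
    apply mul_left_cancel₀ hy'00
    have h1 := hy'x i
    rw [dot_vec] at h1 ⊢
    have h2 := hprop (i, 0)
    have h3 := hprop (i, 1)
    linear_combination dot xi (perp ab i 0) * h2 + dot xi (perp ab i 1) * h3 + y0 (0, 0) * h1
  -- the curve
  set Y := Yv ab v with hY
  have hw0e : ∀ k, (wa Y k).eval 0 = wa (vec (perp ab) y0) k := fun k => by
    have := map_wa (Polynomial.evalRingHom (0 : ℂ)) Y k
    simp only [Polynomial.coe_evalRingHom, hY, Yv_eval_zero] at this
    exact this
  have hwx : ∀ k, xi 0 * (wa Y k).eval 0 = (wa Y 0).eval 0 * xi k := fun k => by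
    rw [hw0e, hw0e]
    have := cross_prop xi _ _ _ (hxiy 0) (hxiy 1) (hxiy 2) k
    rw [wa, this]; ring
  have hw00' : (wa Y 0).eval 0 ≠ 0 := by rwa [← Polynomial.coeff_zero_eq_eval_zero]
  have hw0 : wa Y 0 ≠ 0 := fun h => hw00' (by rw [h, Polynomial.eval_zero])
  have hq : qa (pt ab x0) ≠ 0 := fun h => by
    have := map_qa (Polynomial.evalRingHom (0 : ℂ)) (pt ab x0)
    simp only [Polynomial.coe_evalRingHom, pt_eval_zero] at this
    rw [h, Polynomial.eval_zero] at this
    exact hqp this.symm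
  have hxt : xt x0 0 ≠ 0 := by
    simp [xt, hx00]
  have hsum := trace_lemma (cst ab) (cst (perp ab)) (cst_dot ab) (xt x0) hxt (pol v) hTt
  have hqw := minor_identity' (pt ab x0) Y hsum
  have hdot := dot_wa (pt ab x0) Y hsum hq
  have hcop : IsCoprime (wa Y 0) (wb Y 1) := by
    obtain ⟨p, q, -, -, h⟩ := Polynomial.exists_mul_add_mul_eq_C_resultant (wa Y 0) (wb Y 1)
      (waY_natDegree ab v 0) (wbY_natDegree ab v 1) (by simp)
    set ρ := (wa Y 0).resultant (wb Y 1) 21 21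
    refine ⟨Polynomial.C ρ⁻¹ * p, Polynomial.C ρ⁻¹ * q, ?_⟩
    have h2 : Polynomial.C ρ⁻¹ * Polynomial.C ρ = 1 := by
      rw [← Polynomial.C_mul, inv_mul_cancel₀ hres, Polynomial.C_1]
    linear_combination Polynomial.C ρ⁻¹ * h + h2
  have hYne := wa_ne Y (pt ab x0) hq hqw hw0
  have hfin := curve_vanish ab hD hm' (wa Y) (wb Y) _ _ hqw hq (qb_natDegree ab x0)
    (waY_natDegree ab v) hcop hw0 (pol v) (pol_natDegree v) (fun i => by
      by_contra hcon
      push Not at hcon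
      apply hYne i
      ext1 k
      simp [hY, Yv, vec, hcon]) hdot hlead m hm1 F hF hFi 0
  have h1 := eval_scale hF (xi 0) (fun k => (wa Y k).eval 0)
  have h2 := eval_scale hF ((wa Y 0).eval 0) xi
  rw [hfin, mul_zero] at h1
  simp only [hwx] at h1
  rw [h1] at h2
  simpa [hw00'] using h2.symm

end Main

/-! ### Polynomials as lists of coefficients -/

section Lists

variable {A : Type*} [CommRing A]

/-- polynomial with a given list of coefficients -/
def pl : List A → Polynomial A
  | [] => 0
  | a :: l => Polynomial.C a + Polynomial.X * pl l

def ladd : List A → List A → List A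
  | [], l => l
  | a :: l, [] => a :: l
  | a :: l, b :: l' => (a + b) :: ladd l l'

def lsmul (c : A) (l : List A) : List A := l.map (fun a => c * a)

def lmul : List A → List A → List A
  | [], _ => []
  | a :: l, l' => ladd (lsmul a l') (0 :: lmul l l')

/-- all coefficients vanish -/
def lzero : List A → Prop
  | [] => True
  | a :: l => a = 0 ∧ lzero l

instance lzeroDec [DecidableEq A] : (l : List A) → Decidable (lzero l)
  | [] => isTrue trivial
  | _ :: l => @instDecidableAnd _ _ _ (lzeroDec l)

lemma pl_zero : (l : List A) → lzero l → pl l = 0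
  | [], _ => rfl
  | a :: l, h => by rw [pl, h.1, pl_zero l h.2]; simp

lemma pl_add : (l l' : List A) → pl (ladd l l') = pl l + pl l'
  | [], l' => by simp [ladd, pl]
  | a :: l, [] => by simp [ladd, pl]
  | a :: l, b :: l' => by simp [ladd, pl, pl_add l l']; ring

lemma pl_smul (c : A) : (l : List A) → pl (lsmul c l) = Polynomial.C c * pl l
  | [] => by simp [lsmul, pl]
  | a :: l => by
    have := pl_smul c l
    simp only [lsmul] at this
    simp [lsmul, pl, this]; ring

lemma pl_mul : (l l' : List A) → pl (lmul l l') = pl l * pl l'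
  | [], l' => by simp [lmul, pl]
  | a :: l, l' => by
    simp [lmul, pl, pl_add, pl_smul, pl_mul l l']; ring

lemma pl_coeff : (l : List A) → (n : ℕ) → (pl l).coeff n = l.getD n 0
  | [], n => by simp [pl]
  | a :: l, 0 => by simp [pl]
  | a :: l, n + 1 => by simp [pl, pl_coeff l n]

/-- list version of the minors -/
def ld3 (a b c : Fin 4 → List A) (i j k : Fin 4) : List A :=
  ladd (lmul (a i) (ladd (lmul (b j) (c k)) (lsmul (-1) (lmul (b k) (c j)))))
    (ladd (lsmul (-1) (lmul (a j) (ladd (lmul (b i) (c k)) (lsmul (-1) (lmul (b k) (c i))))))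
      (lmul (a k) (ladd (lmul (b i) (c j)) (lsmul (-1) (lmul (b j) (c i))))))

lemma pl_ld3 (a b c : Fin 4 → List A) (i j k : Fin 4) :
    pl (ld3 a b c i j k) =
      d3 (fun s => pl (a s)) (fun s => pl (b s)) (fun s => pl (c s)) i j k := by
  simp only [ld3, d3, pl_add, pl_mul, pl_smul]
  simp
  ring

def lcross (a b c : Fin 4 → List A) : Fin 4 → List A :=
  ![ld3 a b c 1 2 3, lsmul (-1) (ld3 a b c 0 2 3), ld3 a b c 0 1 3, lsmul (-1) (ld3 a b c 0 1 2)]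

lemma pl_lcross (a b c : Fin 4 → List A) (k) :
    pl (lcross a b c k) = cross (fun s => pl (a s)) (fun s => pl (b s)) (fun s => pl (c s)) k := by
  fin_cases k <;> simp [lcross, cross, pl_ld3, pl_smul]

lemma pol_eq_pl (v : C2 → A) (c) : pol v c = pl (List.ofFn fun n => v (c, n)) := by
  simp [pol, pl, Fin.sum_univ_eight, List.ofFn_succ]
  ring_nf

lemma pol_coeff (v : C2 → A) (c) (n : Fin 8) : (pol v c).coeff n = v (c, n) := by
  rw [pol_eq_pl, pl_coeff, List.getD_eq_getElem _ _ (by simp)]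
  rw [List.getElem_ofFn]

lemma m4_det (u : Fin 6 → Fin 2 → Fin 4 → A) (i j : Fin 6) :
    (m4 u i j).det = -dot (cross (u i 0) (u i 1) (u j 0)) (u j 1) := by
  rw [Matrix.det_succ_row_zero]
  simp [Fin.sum_univ_succ, Matrix.det_fin_three, m4, dot, cross, d3, Fin.succAbove,
    Matrix.submatrix]
  ring

end Lists

/-! ### An explicit example over a finite field -/

section Sample

instance prime101 : Fact (Nat.Prime 101) := ⟨by norm_num⟩

abbrev K : Type := ZMod 101

def sab : Fin 6 → Fin 2 → Fin 4 → K :=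
  ![![![1, 0, 100, 0], ![0, 1, 1, 98]], ![![1, 0, 3, 99], ![0, 1, 2, 99]], ![![1, 0, 1, 1], ![0, 1, 99, 3]], ![![1, 0, 98, 3], ![0, 1, 1, 3]], ![![1, 0, 3, 3], ![0, 1, 100, 98]], ![![1, 0, 3, 2], ![0, 1, 98, 98]]]

def scd : Fin 6 → Fin 2 → Fin 4 → K :=
  ![![![100, 1, 100, 0], ![0, 98, 0, 100]], ![![3, 2, 100, 0], ![99, 99, 0, 100]], ![![1, 99, 100, 0], ![1, 3, 0, 100]], ![![98, 1, 100, 0], ![3, 3, 0, 100]], ![![3, 100, 100, 0], ![3, 98, 0, 100]], ![![3, 98, 100, 0], ![2, 98, 0, 100]]]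

def sxi : Fin 4 → K :=
  ![1, 3, 98, 0]

def sx0 : Fin 4 → K :=
  ![1, 89, 51, 12]

def sB : Fin 6 → Fin 4 → K :=
  ![![9, 6, 9, 5], ![0, 8, 8, 12], ![12, 87, 91, 99], ![56, 3, 89, 3], ![74, 15, 6, 3], ![86, 12, 7, 98]]

def sP : Fin 6 → Fin 4 → K :=
  ![![3, 50, 47, 52], ![66, 72, 39, 27], ![23, 37, 50, 33], ![75, 15, 93, 68], ![2, 12, 95, 71], ![1, 24, 32, 31]]

def sS : Fin 6 → Fin 4 → K :=
  ![![1, 0, 100, 0], ![1, 0, 3, 99], ![1, 0, 1, 1], ![1, 0, 98, 3], ![1, 0, 3, 3], ![1, 0, 3, 2]]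

def szz : Fin 6 → Fin 2 → K :=
  ![![1, 84], ![14, 52], ![65, 87], ![12, 63], ![35, 8], ![95, 58]]

def sio : K :=
  48

def sKi : Fin 6 → Fin 2 → Fin 3 → Fin 4 → K :=
  ![![![![0, 0, 0, 0], ![0, 0, 0, 0], ![0, 0, 0, 1]], ![![22, 15, 41, 27], ![39, 98, 56, 92], ![64, 81, 88, 84]]], ![![![87, 96, 3, 98], ![61, 33, 75, 46], ![80, 69, 17, 14]], ![![95, 45, 12, 23], ![36, 62, 58, 26], ![38, 93, 68, 52]]], ![![![71, 42, 17, 86], ![80, 59, 41, 30], ![25, 68, 72, 65]], ![![20, 93, 84, 62], ![23, 66, 51, 64], ![48, 46, 19, 87]]], ![![![71, 68, 100, 34], ![56, 99, 2, 84], ![97, 51, 81, 12]], ![![66, 42, 18, 78], ![7, 49, 32, 58], ![97, 52, 1, 63]]], ![![![40, 33, 83, 20], ![31, 78, 75, 32], ![85, 71, 42, 35]], ![![27, 27, 24, 27], ![56, 43, 74, 42], ![58, 82, 51, 8]]], ![![![75, 53, 49, 52], ![42, 34, 13, 78], ![81, 16, 42, 95]], ![![25, 10, 35, 66], ![21, 89,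 27, 79], ![45, 4, 54, 58]]]]

def sTi : Fin 6 → Fin 2 → Fin 3 → Fin 4 → K :=
  ![![![![0, 0, 0, 0], ![0, 0, 0, 0], ![0, 0, 0, 1]], ![![37, 30, 74, 65], ![76, 53, 53, 13], ![11, 61, 34, 23]]], ![![![54, 82, 3, 16], ![96, 25, 97, 76], ![59, 68, 71, 73]], ![![52, 85, 24, 68], ![16, 2, 66, 21], ![22, 12, 11, 59]]], ![![![56, 88, 21, 17], ![40, 12, 38, 40], ![5, 23, 43, 14]], ![![13, 37, 75, 69], ![28, 49, 87, 64], ![84, 27, 62, 23]]], ![![![35, 18, 17, 27], ![92, 40, 56, 35], ![100, 51, 55, 64]], ![![10, 66, 70, 57], ![19, 35, 97, 90], ![38, 79, 22, 85]]], ![![![7, 55, 89, 41], ![70, 27, 52, 75], ![98, 32, 58, 35]], ![![54, 45, 45, 64], ![5, 62, 100, 28], ![97, 9, 42, 68]]], ![![![84, 93, 76, 82], ![46, 70, 86, 76], ![11, 83, 95, 87]], ![![4, 12, 17, 21], ![77, 75, 36, 44], ![46, 36, 52, 6]]]]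

def sy : Fin 6 → Fin 2 → Fin 8 → K :=
  ![![![1, 64, 74, 23, 27, 60, 67, 53], ![23, 54, 58, 27, 74, 37, 50, 79]], ![![73, 28, 23, 92, 67, 2, 97, 18], ![59, 27, 72, 84, 53, 65, 39, 84]], ![![14, 43, 72, 76, 31, 87, 65, 88], ![23, 3, 41, 89, 73, 96, 59, 45]], ![![64, 29, 1, 19, 72, 79, 22, 70], ![85, 40, 33, 36, 45, 83, 63, 67]], ![![35, 0, 7, 75, 60, 4, 34, 95], ![68, 90, 76, 73, 74, 57, 41, 68]], ![![87, 77, 11, 44, 45, 37, 15, 80], ![6, 98, 80, 30, 31, 34, 32, 61]]]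

def sY : Fin 6 → Fin 4 → List K :=
  ![![[100, 37, 27, 78, 74, 41, 34, 48], [33, 3, 1, 43, 7, 50, 18, 18], [100, 37, 27, 78, 74, 41, 34, 48], [78, 47, 43, 74, 27, 64, 51, 22]],
    ![[0, 30, 26, 7, 95, 78, 11, 88], [28, 2, 3, 16, 28, 76, 15, 70], [28, 73, 78, 9, 34, 99, 4, 83], [42, 74, 29, 17, 48, 36, 62, 17]],
    ![[37, 46, 12, 64, 3, 82, 23, 32], [41, 24, 80, 14, 56, 13, 47, 60], [87, 58, 29, 25, 70, 14, 36, 13], [78, 98, 60, 12, 28, 5, 42, 56]],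
    ![[63, 33, 96, 51, 20, 12, 22, 92], [16, 48, 100, 26, 5, 25, 9, 69], [37, 72, 100, 82, 29, 22, 79, 31], [16, 61, 68, 65, 56, 18, 38, 34]],
    ![[6, 68, 47, 40, 99, 82, 23, 85], [64, 33, 68, 9, 21, 27, 45, 4], [66, 0, 94, 26, 41, 97, 67, 6], [33, 11, 25, 28, 27, 44, 60, 33]],
    ![[71, 23, 92, 91, 96, 78, 8, 59], [24, 81, 30, 81, 75, 90, 61, 82], [14, 24, 90, 57, 56, 64, 86, 21], [95, 3, 21, 71, 70, 67, 69, 40]]]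

def sW : Fin 4 → List K :=
  ![[98, 86, 29, 80, 11, 15, 72, 5, 67, 96, 59, 61, 39, 2, 13, 6, 68, 30, 36, 37, 66, 22],
    [92, 5, 72, 15, 100, 61, 3, 54, 95, 12, 89, 37, 77, 82, 23, 86, 87, 32, 25, 25, 80, 92],
    [9, 97, 26, 48, 56, 52, 9, 68, 15, 98, 96, 95, 42, 53, 35, 37, 96, 13, 8, 34, 100, 9],
    [0, 56, 34, 85, 9, 70, 72, 90, 88, 67, 10, 9, 97, 68, 45, 3, 4, 79, 97, 0, 0, 4]]

def sW1 : List K :=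
  [71, 24, 2, 71, 34, 98, 63, 49, 51, 88, 25, 40, 89, 93, 16, 67, 69, 33, 97, 49, 77, 89]

def su : List K :=
  [69, 22, 68, 68, 47, 62, 63, 5, 21, 22, 94, 9, 44, 95, 70, 26, 19, 71, 56, 77, 63]

def sv : List K :=
  [20, 50, 33, 53, 34, 43, 72, 53, 52, 86, 74, 71, 73, 32, 34, 52, 44, 51, 18, 21, 65]

def sc0 : List K :=
  [30, 50, 95, 51, 21, 22, 80]

def sc1 : List K :=
  [69, 29, 89, 27, 51, 36, 55]

lemma s_perp : perp sab = scd := by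
  have : ∀ i e k, perp sab i e k = scd i e k := by decide +kernel
  funext i e k; exact this i e k

lemma s_B : dualpt scd sxi = sB := by
  have : ∀ i k, dualpt scd sxi i k = sB i k := by decide +kernel
  funext i k; exact this i k

lemma s_P : dualpt sab sx0 = sP := by
  have : ∀ i k, dualpt sab sx0 i k = sP i k := by decide +kernel
  funext i k; exact this i k

lemma s_K : Kmat sab sxi = theta sab sB := by rw [Kmat, s_perp, s_B]

lemma left_inv_ne (M : Matrix (Fin 3 × Fin 4) (Fin 6 × Fin 2) K)
    (N : Fin 6 → Fin 2 → Fin 3 → Fin 4 → K)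
    (h : ∀ c c' : Fin 6 × Fin 2, ∑ r : Fin 3 × Fin 4, N c.1 c.2 r.1 r.2 * M r c' =
      if c = c' then 1 else 0) : dt e1 M ≠ 0 := by
  apply dt_ne_zero
  intro v hv
  have h2 : (Matrix.of fun (c : Fin 6 × Fin 2) (r : Fin 3 × Fin 4) => N c.1 c.2 r.1 r.2) * M = 1 := by
    ext c c'
    rw [Matrix.mul_apply, Matrix.one_apply]
    exact h c c'
  rw [← Matrix.one_mulVec v, ← h2, ← Matrix.mulVec_mulVec]
  have : M.mulVec v = 0 := by ext r; exact hv r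
  rw [this, Matrix.mulVec_zero]

lemma s_detK : dt e1 (theta sab sB) ≠ 0 := left_inv_ne _ sKi (by decide +kernel)

lemma s_detT : dt e1 (theta scd sP) ≠ 0 := left_inv_ne _ sTi (by decide +kernel)

lemma s_zz : ∀ r, (theta sab sB).mulVec (fun c => szz c.1 c.2) r = if r = (2, 3) then 1 else 0 := by
  decide +kernel

lemma s_x0 : ∀ k, sio * wa (vec sab (fun c => szz c.1 c.2)) k = sx0 k := by decide +kernel

lemma vec_smul {A : Type*} [CommRing A] (δ : A) (u : Fin 6 → Fin 2 → Fin 4 → A)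
    (z : Fin 6 × Fin 2 → A) (i k) : vec u (fun c => δ * z c) i k = δ * vec u z i k := by
  simp [vec, Fin.sum_univ_two]; ring

lemma cross_smul {A : Type*} [CommRing A] (δ : A) (a b c : Fin 4 → A) (k) :
    cross (fun s => δ * a s) (fun s => δ * b s) (fun s => δ * c s) k = δ ^ 3 * cross a b c k := by
  fin_cases k <;> simp [cross, d3] <;> ring

lemma s_xx : ∃ th, xx sab sxi th = sx0 := by
  have h := sol_eq e1 (Kmat sab sxi) (2, 3) (fun c => szz c.1 c.2) (by rw [s_K]; exact s_zz)
  have hδ : dt e1 (Kmat sab sxi) ≠ 0 := by rw [s_K]; exact s_detK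
  set δ := dt e1 (Kmat sab sxi)
  refine ⟨(δ ^ 3)⁻¹ * sio, ?_⟩
  ext1 k
  have h1 : vec sab (sol e1 (Kmat sab sxi) (2, 3)) =
      fun i k => δ * vec sab (fun c => szz c.1 c.2) i k := by
    rw [h]
    ext1 i; ext1 k
    exact vec_smul δ sab _ i k
  have h2 : wa (fun i k => δ * vec sab (fun c => szz c.1 c.2) i k) k =
      δ ^ 3 * wa (vec sab (fun c => szz c.1 c.2)) k := cross_smul _ _ _ _ _
  rw [xx, h1, h2, ← s_x0]
  field_simp

lemma s_N1 : N1 sab sxi ≠ 0 := by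
  have h1 : ∀ i, sab i 0 0 * sab i 1 1 - sab i 0 1 * sab i 1 0 ≠ 0 := by decide +kernel
  have h2 : ∀ i j, i ≠ j → -dot (cross (scd i 0) (scd i 1) (scd j 0)) (scd j 1) ≠ 0 := by
    decide +kernel
  have h3 : qa sB ≠ 0 := by decide +kernel
  have h4 : ∀ i, dot sxi (scd i 0) ≠ 0 := by decide +kernel
  have h5 : sxi 0 ≠ 0 := by decide +kernel
  simp only [N1, mul_ne_zero_iff, Finset.prod_ne_zero_iff, Finset.mem_univ, true_imp_iff, s_K,
    s_perp, s_B]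
  refine ⟨⟨⟨⟨⟨h1, fun i j => ?_⟩, s_detK⟩, h3⟩, h4⟩, h5⟩
  split_ifs with hij
  · exact one_ne_zero
  · rw [m4_det]; exact h2 i j hij

/-- the example curve -/
def sv0 : C2 → K := fun c => sy c.1.1 c.1.2 c.2

lemma s_Y : Yv sab sv0 = fun i k => pl (sY i k) := by
  have h : ∀ i k, sY i k = ladd (lsmul (scd i 0 k) (List.ofFn fun n => sv0 ((i, 0), n)))
      (lsmul (scd i 1 k) (List.ofFn fun n => sv0 ((i, 1), n))) := by decide +kernel
  ext1 i; ext1 k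
  rw [h, pl_add, pl_smul, pl_smul, ← pol_eq_pl, ← pol_eq_pl, Yv, s_perp]
  simp only [vec, cst, Fin.sum_univ_two]
  ring

lemma s_pt (i k) : pt sab sx0 i k = pl [sP i k, sS i k] := by
  have h : ∀ i k, sab i 1 1 * sab i 0 k - sab i 0 1 * sab i 1 k = sS i k := by decide +kernel
  rw [pt_eq, s_P, h]
  simp [pl]

lemma s_Tt (r) (hr : r ≠ (2, 3)) : (Tt sab sx0).mulVec (pol sv0) r = 0 := by
  have h : ∀ (k : Fin 3) (j : Fin 4), (k, j) ≠ (2, 3) →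
      lzero (ladd (lmul [sP 0 k.succ, sS 0 k.succ] (sY 0 j))
      (ladd (lmul [sP 1 k.succ, sS 1 k.succ] (sY 1 j))
      (ladd (lmul [sP 2 k.succ, sS 2 k.succ] (sY 2 j))
      (ladd (lmul [sP 3 k.succ, sS 3 k.succ] (sY 3 j))
      (ladd (lmul [sP 4 k.succ, sS 4 k.succ] (sY 4 j))
      (lmul [sP 5 k.succ, sS 5 k.succ] (sY 5 j))))))) := by decide +kernel
  obtain ⟨k, j⟩ := r
  rw [Tt, theta_mulVec _ _ _ _ _ hr]
  have hY : vec (cst (perp sab)) (pol sv0) = fun i k => pl (sY i k) := s_Y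
  have := pl_zero _ (h k j hr)
  simp only [pl_add, pl_mul] at this
  rw [hY, Fin.sum_univ_six]
  simp only [s_pt]
  linear_combination this

lemma s_Smat (r) : (Smat sab sx0).mulVec sv0 r = if r = r02 then 1 else 0 := by
  rw [Smat_mulVec]
  split_ifs with h
  · subst h
    have h2 : (Tt sab sx0).mulVec (pol sv0) r02.1 = pol sv0 (0, 0) := theta_norm _ _ _
    have h3 : ((r02.2 : Fin _) : ℕ) = ((0 : Fin 8) : ℕ) := rfl
    rw [h2, h3, pol_coeff]
    decide +kernel
  · rw [s_Tt, Polynomial.coeff_zero]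
    intro hr
    apply h
    obtain ⟨r, l⟩ := r
    simp only at hr
    subst hr
    have : Subsingleton (Fin (dg (2, 3))) := by
      have : dg (2, 3) = 1 := rfl
      rw [this]; infer_instance
    rw [r02]
    congr 1
    exact Subsingleton.elim _ _

lemma s_detTt : dt e1 (Tt sab sx0) ≠ 0 := fun h => by
  have := map_dt (Polynomial.evalRingHom (0 : K)) e1 (Tt sab sx0)
  simp only [Polynomial.coe_evalRingHom, Tt_eval_zero] at this
  rw [h, Polynomial.eval_zero, s_perp, s_P] at this
  exact s_detT this.symm

lemma s_detS : dt e2 (Smat sab sx0) ≠ 0 := by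
  apply dt_ne_zero
  intro v hv
  have hTt := Tt_mulVec_zero sab sx0 v (fun r _ => hv r)
  have hv0 : v ((0, 0), 0) = 0 := by
    have h1 := Smat_mulVec sab sx0 v r02
    have h2 : (Tt sab sx0).mulVec (pol v) r02.1 = pol v (0, 0) := theta_norm _ _ _
    have h3 : ((r02.2 : Fin _) : ℕ) = ((0 : Fin 8) : ℕ) := rfl
    rw [hv, h2, h3, pol_coeff] at h1
    exact h1.symm
  have hprop : ∀ c, pol sv0 (0, 0) * pol v c = pol v (0, 0) * pol sv0 c := by
    have := eq_zero_of_mulVec e1 _ s_detTt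
      (pol sv0 (0, 0) • pol v - pol v (0, 0) • pol sv0) (fun r => by
      rw [Matrix.mulVec_sub, Matrix.mulVec_smul, Matrix.mulVec_smul]
      by_cases hr : r = (2, 3)
      · subst hr
        simp only [Pi.sub_apply, Pi.smul_apply, Tt, theta_norm, smul_eq_mul]
        ring
      · simp [hTt r hr, s_Tt r hr])
    intro c
    have := congrFun this c
    simp only [Pi.sub_apply, Pi.smul_apply, smul_eq_mul, Pi.zero_apply] at this
    linear_combination this
  have hbez : pl sc0 * pol sv0 (0, 0) + pl sc1 * pol sv0 (0, 1) = 1 := by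
    have h : lzero (ladd (lmul sc0 (List.ofFn fun n => sv0 ((0, 0), n)))
        (ladd (lmul sc1 (List.ofFn fun n => sv0 ((0, 1), n))) [-1])) := by decide +kernel
    have := pl_zero _ h
    rw [pl_add, pl_add, pl_mul, pl_mul, ← pol_eq_pl, ← pol_eq_pl] at this
    simp only [pl, map_neg, Polynomial.C_1] at this
    linear_combination this
  have h7 : (pol sv0 (0, 0)).coeff ((7 : Fin 8) : ℕ) ≠ 0 := by
    rw [pol_coeff]; decide +kernel
  have hs0 : sv0 ((0, 0), 0) = 1 := by decide +kernel
  set y := pol sv0 (0, 0) with hy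
  have hy0 : y ≠ 0 := fun h => h7 (by rw [h]; simp)
  set f := pl sc0 * pol v (0, 0) + pl sc1 * pol v (0, 1) with hf
  have hfy : pol v (0, 0) = y * f := by
    have := hprop (0, 1)
    linear_combination -pol v (0, 0) * hbez - pl sc1 * this
  have hf0 : f = 0 := by
    by_contra hne
    have hd := pol_natDegree v (0, 0)
    rw [hfy, Polynomial.natDegree_mul hy0 hne] at hd
    have h8 : 7 ≤ y.natDegree := Polynomial.le_natDegree_of_ne_zero h7
    have hfd : f.natDegree = 0 := by omega
    obtain ⟨a, ha⟩ := Polynomial.natDegree_eq_zero.mp hfd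
    have h9 := pol_coeff v (0, 0) 0
    rw [hv0, hfy, ← ha, Polynomial.coeff_mul_C, hy, pol_coeff, hs0, one_mul] at h9
    rw [h9] at ha
    exact hne (by rw [← ha, Polynomial.C_0])
  have hall : ∀ c, pol v c = 0 := fun c => by
    have := hprop c
    rw [hfy, hf0, mul_zero, zero_mul] at this
    simpa [hy0] using this
  ext ⟨c, n⟩
  have h10 := pol_coeff v c n
  rw [hall, Polynomial.coeff_zero] at h10
  exact h10.symm

lemma s_N2 : N2 sab sx0 ≠ 0 := by
  have h1 : ∀ i, dot sx0 (sab i 1) ≠ 0 := by decide +kernel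
  have h2 : qa sP ≠ 0 := by decide +kernel
  have h3 : sx0 0 ≠ 0 := by decide +kernel
  simp only [N2, mul_ne_zero_iff, Finset.prod_ne_zero_iff, Finset.mem_univ, true_imp_iff,
    s_perp, s_P]
  exact ⟨⟨⟨⟨h1, s_detT⟩, s_detS⟩, h3⟩, h2⟩

lemma s_wa (k) : wa (Yv sab sv0) k = pl (sW k) := by
  have h : ∀ k, lcross (sY 0) (sY 1) (sY 2) k = sW k := by decide +kernel
  rw [← h, pl_lcross, s_Y]; rfl

lemma s_wb : wb (Yv sab sv0) 1 = pl sW1 := by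
  have h : lcross (sY 3) (sY 4) (sY 5) 1 = sW1 := by decide +kernel
  rw [← h, pl_lcross, s_Y]; rfl

lemma s_cop : IsCoprime (pl (sW 0)) (pl sW1) := by
  have h : lzero (ladd (lmul su (sW 0)) (ladd (lmul sv sW1) [-1])) := by decide +kernel
  have := pl_zero _ h
  simp only [pl_add, pl_mul, pl, map_neg, Polynomial.C_1] at this
  exact ⟨pl su, pl sv, by linear_combination this⟩

lemma s_N3 (δ : K) (hδ : δ ≠ 0) : N3 sab (fun c => δ * sv0 c) ≠ 0 := by
  have hY : Yv sab (fun c => δ * sv0 c) = fun i k => Polynomial.C δ * Yv sab sv0 i k := by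
    ext1 i; ext1 k
    have hp : pol (fun c => δ * sv0 c) = fun c => Polynomial.C δ * pol sv0 c := by
      ext1 c
      simp only [pol, Finset.mul_sum, Polynomial.C_mul, mul_assoc]
    rw [Yv, hp]
    exact vec_smul _ _ _ _ _
  have hwa : ∀ k, wa (Yv sab (fun c => δ * sv0 c)) k = Polynomial.C (δ ^ 3) * pl (sW k) := fun k => by
    rw [hY, Polynomial.C_pow, ← s_wa]
    exact cross_smul _ _ _ _ _
  have hwb : wb (Yv sab (fun c => δ * sv0 c)) 1 = Polynomial.C (δ ^ 3) * pl sW1 := by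
    rw [hY, Polynomial.C_pow, ← s_wb]
    exact cross_smul _ _ _ _ _
  have ha : (pl (sW 0)).natDegree = 21 := by
    apply le_antisymm
    · rw [← s_wa]; exact waY_natDegree _ _ _
    · apply Polynomial.le_natDegree_of_ne_zero
      rw [pl_coeff]; decide +kernel
  have hb : (pl sW1).natDegree = 21 := by
    apply le_antisymm
    · rw [← s_wb]; exact wbY_natDegree _ _ _
    · apply Polynomial.le_natDegree_of_ne_zero
      rw [pl_coeff]; decide +kernel
  have hres := Polynomial.resultant_ne_zero _ _ s_cop
  rw [ha, hb] at hres
  have hlead : ∀ i, dot (scd i 0) (fun k => (sW k).getD 21 0) ≠ 0 := by decide +kernel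
  have h0 : (sW 0).getD 0 0 ≠ 0 := by decide +kernel
  have hδ3 : δ ^ 3 ≠ 0 := pow_ne_zero _ hδ
  have hl : ∀ i, leadc sab (wa (Yv sab (fun c => δ * sv0 c))) i =
      δ ^ 3 * dot (scd i 0) (fun k => (sW k).getD 21 0) := fun i => by
    simp only [leadc, hwa, Polynomial.coeff_C_mul, pl_coeff, s_perp]
    rw [dot_comm, dot_smul_left, dot_comm]
  simp only [N3, mul_ne_zero_iff, Finset.prod_ne_zero_iff, Finset.mem_univ, true_imp_iff, hl]
  refine ⟨⟨?_, fun i => ⟨hδ3, hlead i⟩⟩, ?_⟩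
  · rw [hwa, hwb, Polynomial.resultant_C_mul_left, Polynomial.resultant_C_mul_right]
    exact mul_ne_zero (pow_ne_zero _ hδ3) (mul_ne_zero (pow_ne_zero _ hδ3) hres)
  · rw [hwa, Polynomial.coeff_C_mul, pl_coeff]
    exact mul_ne_zero hδ3 h0

theorem sample : ∃ (ab : Fin 6 → Fin 2 → Fin 4 → K) (xi : Fin 4 → K) (th : K), NN ab xi th ≠ 0 := by
  obtain ⟨th, hth⟩ := s_xx
  refine ⟨sab, sxi, th, ?_⟩
  rw [NN, hth, sol_eq e2 _ _ _ s_Smat]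
  exact mul_ne_zero (mul_ne_zero s_N1 s_N2) (s_N3 _ s_detS)

end Sample

/-! ### The conclusion -/

section Final

lemma li_of_N (v : Fin 6 → Fin 2 → C4) (i : Fin 6)
    (h : v i 0 0 * v i 1 1 - v i 0 1 * v i 1 0 ≠ 0) : LinearIndependent ℂ ![v i 0, v i 1] := by
  rw [LinearIndependent.pair_iff]
  intro s t hst
  have h0 : s * v i 0 0 + t * v i 1 0 = 0 := congrFun hst 0
  have h1 : s * v i 0 1 + t * v i 1 1 = 0 := congrFun hst 1
  constructor
  · apply (mul_eq_zero.mp _).resolve_right h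
    linear_combination v i 1 1 * h0 - v i 1 0 * h1
  · apply (mul_eq_zero.mp _).resolve_right h
    linear_combination v i 0 0 * h1 - v i 0 1 * h0

lemma perp_span (v : Fin 6 → Fin 2 → C4) (i : Fin 6) (e : Fin 2) (x : C4)
    (hx : x ∈ Submodule.span ℂ {v i 0, v i 1}) : dot (perp v i e) x = 0 := by
  obtain ⟨s, t, rfl⟩ := Submodule.mem_span_pair.mp hx
  have h0 := perp_dot v i e 0
  have h1 := perp_dot v i e 1
  simp only [dot, Fin.sum_univ_four, Pi.add_apply, Pi.smul_apply, smul_eq_mul] at h0 h1 ⊢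
  linear_combination s * h0 + t * h1

lemma skew_of_N (v : Fin 6 → Fin 2 → C4) (i j : Fin 6)
    (h : (m4 (perp v) i j).det ≠ 0) :
    Submodule.span ℂ {v i 0, v i 1} ⊓ Submodule.span ℂ {v j 0, v j 1} = ⊥ := by
  rw [Submodule.eq_bot_iff]
  rintro x ⟨hi, hj⟩
  apply Matrix.eq_zero_of_mulVec_eq_zero h
  ext r
  fin_cases r
  · exact perp_span v i 0 x hi
  · exact perp_span v i 1 x hi
  · exact perp_span v j 0 x hj
  · exact perp_span v j 1 x hj

theorem final :
    GeneralLines 6 (fun L =>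
      ∀ m : ℕ, 1 ≤ m → ∀ F : R3,
        F.IsHomogeneous (72 * m - 1) → (∀ i, F ∈ (lineIdeal (L i)) ^ (19 * m)) →
        F = 0) := by
  obtain ⟨ab, xi, th, hs⟩ := sample
  choose l hl using (ZMod.intCast_surjective : Function.Surjective (Int.cast : ℤ → ZMod 101))
  set PZ : MvPolynomial (Fin 6 × Fin 2 × Fin 4) ℤ :=
    NN (fun i e k => X (i, e, k)) (fun s => C (l (xi s))) (C (l th)) with hPZ
  have hPZ0 : PZ ≠ 0 := by
    intro h0
    have h1 := map_NN (eval₂Hom (Int.castRingHom (ZMod 101)) (fun p => ab p.1 p.2.1 p.2.2))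
      (fun i e k => X (i, e, k)) (fun s => C (l (xi s))) (C (l th))
    rw [← hPZ, h0, map_zero] at h1
    simp only [coe_eval₂Hom, eval₂_X, eval₂_C, Int.coe_castRingHom, hl] at h1
    exact hs h1.symm
  refine ⟨map (Int.castRingHom ℂ) PZ, ?_, fun v hv => ?_⟩
  · rw [Ne, ← map_zero (map (Int.castRingHom ℂ))]
    exact fun h => hPZ0 (map_injective _ (RingHom.injective_int _) h)
  have hN : NN v (fun s => ((l (xi s) : ℤ) : ℂ)) ((l th : ℤ) : ℂ) ≠ 0 := by
    have h1 := map_NN (eval₂Hom (Int.castRingHom ℂ) (fun p => v p.1 p.2.1 p.2.2))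
      (fun i e k => X (i, e, k)) (fun s => C (l (xi s))) (C (l th))
    rw [← hPZ] at h1
    simp only [coe_eval₂Hom, eval₂_X, eval₂_C, Int.coe_castRingHom] at h1
    rw [eval_map] at hv
    rw [h1] at hv
    exact hv
  have hN1 := hN
  simp only [NN, N1, mul_ne_zero_iff, Finset.prod_ne_zero_iff, Finset.mem_univ,
    true_imp_iff] at hN1
  refine ⟨fun i => li_of_N v i (hN1.1.1.1.1.1.1.1 i), fun i j hij => skew_of_N v i j ?_, ?_⟩
  · have := hN1.1.1.1.1.1.1.2 i j
    rwa [if_neg hij] at this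
  intro m hm F hF hFi
  set Nx : R3 := NN (fun i e k => C (v i e k)) (fun s => X s) (C ((l th : ℤ) : ℂ)) with hNx
  have hev : ∀ x : C4, eval x Nx = NN v x ((l th : ℤ) : ℂ) := fun x => by
    rw [hNx, map_NN]
    simp only [eval_C, eval_X]
  have hNx0 : Nx ≠ 0 := by
    intro h0
    have := hev (fun s => ((l (xi s) : ℤ) : ℂ))
    rw [h0, map_zero] at this
    exact hN this.symm
  have hprod : F * Nx = 0 := by
    apply MvPolynomial.funext
    intro x
    rw [map_mul, map_zero, hev]
    by_cases h : NN v x ((l th : ℤ) : ℂ) = 0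
    · rw [h, mul_zero]
    · rw [main_vanish v x _ h m hm F hF hFi, zero_mul]
  exact (mul_eq_zero.mp hprod).resolve_right hNx0

end Final

end SixLines

/-- For six general lines in `P^3` and every `m ≥ 1`, the only homogeneous form
of degree `72m - 1` with multiplicity `19m` along all six lines is `0`. -/
theorem stmt_17 :
    GeneralLines 6 (fun L =>
      ∀ m : ℕ, 1 ≤ m → ∀ F : R3,
        F.IsHomogeneous (72 * m - 1) → (∀ i, F ∈ (lineIdeal (L i)) ^ (19 * m)) →
        F = 0) := by
  exact SixLines.final
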